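/- Let S be a set of n points in convex position in general position such that the topmost point t(S) lies strictly to the right of the bottommost point b(S). Then every path P = d_1,...,d_{n-1} with all labels in {U,D,R} admits a planar direction-consistent embedding on S. -/

import Mathlib

/-- Edge direction labels. -/
inductive Dir | U | D | L | R
deriving DecidableEq

/-- Opposite label: U↔D, L↔R. -/
def Dir.opp : Dir → Dir
  | .U => .D | .D => .U | .L => .R | .R => .L

/-- Label after counterclockwise rotation by π/2: U↦L, D↦R, R↦U, L↦D. -/
def Dir.rot : Dir → Dir
  | .U => .L | .D => .R | .R => .U | .L => .D

/-- Label after vertical-line reflection: U↦U, D↦D, R↦L, L↦R. -/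
def Dir.mir : Dir → Dir
  | .U => .U | .D => .D | .R => .L | .L => .R

/-- An edge from `a` to `b` is consistent with a direction label. -/
def dirOk : Dir → ℝ × ℝ → ℝ × ℝ → Prop
  | .U, a, b => a.2 < b.2
  | .D, a, b => b.2 < a.2
  | .R, a, b => a.1 < b.1
  | .L, a, b => b.1 < a.1

/-- The drawing of a path with edge labels `d` and vertex placement `E` is
direction-consistent. -/
def DirConsistent {m : ℕ} (d : Fin m → Dir) (E : Fin (m + 1) → ℝ × ℝ) : Prop :=
  ∀ i : Fin m, dirOk (d i) (E i.castSucc) (E i.succ)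

/-- The straight-line drawing of the path with vertex placement `E` is planar:
non-adjacent segments are disjoint; adjacent segments meet only at the shared endpoint. -/
def PlanarDrawing {m : ℕ} (E : Fin (m + 1) → ℝ × ℝ) : Prop :=
  (∀ i j : Fin m, (i : ℕ) + 1 < (j : ℕ) →
    segment ℝ (E i.castSucc) (E i.succ) ∩ segment ℝ (E j.castSucc) (E j.succ) = ∅) ∧
  (∀ i j : Fin m, (i : ℕ) + 1 = (j : ℕ) →
    segment ℝ (E i.castSucc) (E i.succ) ∩ segment ℝ (E j.castSucc) (E j.succ) = {E i.succ})

/-- `E` is an embedding of the path vertices onto the point set `S`. -/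
def EmbOn {m : ℕ} (E : Fin (m + 1) → ℝ × ℝ) (S : Set (ℝ × ℝ)) : Prop :=
  Function.Injective E ∧ Set.range E = S

/-- Planar direction-consistent embedding of the labeled path `d` on `S`. -/
def PDCE {m : ℕ} (d : Fin m → Dir) (E : Fin (m + 1) → ℝ × ℝ) (S : Set (ℝ × ℝ)) : Prop :=
  EmbOn E S ∧ DirConsistent d E ∧ PlanarDrawing E

/-- `S` is in convex position. -/
def ConvexPos (S : Set (ℝ × ℝ)) : Prop :=
  ConvexIndependent ℝ ((↑) : S → ℝ × ℝ)

/-- No three distinct points of `S` are collinear. -/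
def NoThreeCollinear (S : Set (ℝ × ℝ)) : Prop :=
  ∀ p ∈ S, ∀ q ∈ S, ∀ r ∈ S, p ≠ q → p ≠ r → q ≠ r →
    ¬ Collinear ℝ ({p, q, r} : Set (ℝ × ℝ))

/-- General position: no three collinear, no two points with equal x- or y-coordinate. -/
def GenPos (S : Set (ℝ × ℝ)) : Prop :=
  NoThreeCollinear S ∧ ∀ p ∈ S, ∀ q ∈ S, p ≠ q → p.1 ≠ q.1 ∧ p.2 ≠ q.2

def IsTopmost (S : Set (ℝ × ℝ)) (t : ℝ × ℝ) : Prop :=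
  t ∈ S ∧ ∀ p ∈ S, p ≠ t → p.2 < t.2
def IsBottommost (S : Set (ℝ × ℝ)) (b : ℝ × ℝ) : Prop :=
  b ∈ S ∧ ∀ p ∈ S, p ≠ b → b.2 < p.2
def IsLeftmost (S : Set (ℝ × ℝ)) (l : ℝ × ℝ) : Prop :=
  l ∈ S ∧ ∀ p ∈ S, p ≠ l → l.1 < p.1
def IsRightmost (S : Set (ℝ × ℝ)) (r : ℝ × ℝ) : Prop :=
  r ∈ S ∧ ∀ p ∈ S, p ≠ r → p.1 < r.1

/-- Cross product telling on which side of the directed line `a → b` the point `p` lies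
(`0 < cross a b p` means `p` is strictly to the left). -/
def cross (a b p : ℝ × ℝ) : ℝ :=
  (b.1 - a.1) * (p.2 - a.2) - (b.2 - a.2) * (p.1 - a.1)

/-- With `b` bottommost and `t` topmost, all other points lie strictly to the left of the
line through `b` and `t`. -/
def LeftSided (S : Set (ℝ × ℝ)) (b t : ℝ × ℝ) : Prop :=
  IsBottommost S b ∧ IsTopmost S t ∧ ∀ p ∈ S, p ≠ b → p ≠ t → 0 < cross b t p

/-- With `b` bottommost and `t` topmost, all other points lie strictly to the right of the
line through `b` and `t`. -/
def RightSided (S : Set (ℝ × ℝ)) (b t : ℝ × ℝ) : Prop :=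
  IsBottommost S b ∧ IsTopmost S t ∧ ∀ p ∈ S, p ≠ b → p ≠ t → cross b t p < 0

/-- Two points of `S` are consecutive on the convex hull of `S`: all other points of `S`
lie strictly on one side of the line through them. -/
def HullConsecutive (S : Set (ℝ × ℝ)) (p q : ℝ × ℝ) : Prop :=
  p ∈ S ∧ q ∈ S ∧ p ≠ q ∧
    ((∀ r ∈ S, r ≠ p → r ≠ q → 0 < cross p q r) ∨
     (∀ r ∈ S, r ≠ p → r ≠ q → cross p q r < 0))

/-- Strip-convex point set with bottommost `b`, leftmost `l`, topmost `t`, rightmost `r`: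
`b` and `l` coincide or are hull-consecutive, and so do `t` and `r`. -/
def StripConvex (S : Set (ℝ × ℝ)) (b l t r : ℝ × ℝ) : Prop :=
  IsBottommost S b ∧ IsLeftmost S l ∧ IsTopmost S t ∧ IsRightmost S r ∧
    (b = l ∨ HullConsecutive S b l) ∧ (t = r ∨ HullConsecutive S t r)

/-- `T` is a consecutive subset of the convex point set `S` along its hull:
it can be separated from `S \ T` by a line. -/
def Consecutive (S T : Set (ℝ × ℝ)) : Prop :=
  T ⊆ S ∧ ∃ f : (ℝ × ℝ) →ₗ[ℝ] ℝ, ∃ c : ℝ,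
    (∀ p ∈ T, c < f p) ∧ ∀ p ∈ S \ T, f p < c

open scoped Pointwise

/-- The linear functional that increases along an edge with the given label. -/
def Dir.key : Dir → ℝ × ℝ → ℝ
  | .U, p => p.2
  | .D, p => -p.2
  | .R, p => p.1
  | .L, p => -p.1

theorem dirOk_iff_key (e : Dir) (p q : ℝ × ℝ) : dirOk e p q ↔ e.key p < e.key q := by
  cases e <;> simp [dirOk, Dir.key]

theorem key_neg (e : Dir) (p : ℝ × ℝ) : e.key (-p) = -e.key p := by
  cases e <;> simp [Dir.key]

theorem dirOk_neg (e : Dir) (p q : ℝ × ℝ) : dirOk e (-p) (-q) ↔ dirOk e q p := by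
  simp only [dirOk_iff_key, key_neg, neg_lt_neg_iff]

theorem cross_neg (p q r : ℝ × ℝ) : cross (-p) (-q) (-r) = cross p q r := by
  simp only [cross, Prod.fst_neg, Prod.snd_neg]; ring

/-- A finite point set in convex and general position, described by orientation predicates, whose
topmost point `t` lies to the right of its bottommost point `b`. -/
structure Config (S : Finset (ℝ × ℝ)) (b t : ℝ × ℝ) : Prop where
  b_mem : b ∈ S
  t_mem : t ∈ S
  b_low : ∀ p ∈ S, p ≠ b → b.2 < p.2
  t_high : ∀ p ∈ S, p ≠ t → p.2 < t.2
  b_left : b.1 < t.1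
  no_triangle : ∀ p ∈ S, ∀ q ∈ S, ∀ r ∈ S, ∀ s ∈ S,
    0 < cross p q s → 0 < cross q r s → 0 < cross r p s → False
  cross_ne : ∀ p ∈ S, ∀ q ∈ S, ∀ r ∈ S, p ≠ q → p ≠ r → q ≠ r → cross p q r ≠ 0
  fst_ne : ∀ p ∈ S, ∀ q ∈ S, p ≠ q → p.1 ≠ q.1
  snd_ne : ∀ p ∈ S, ∀ q ∈ S, p ≠ q → p.2 ≠ q.2

theorem collinear_of_cross_eq_zero {p q r : ℝ × ℝ} (hpq : p.1 ≠ q.1) (h : cross p q r = 0) :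
    Collinear ℝ ({p, q, r} : Set (ℝ × ℝ)) := by
  have hne : q.1 - p.1 ≠ 0 := sub_ne_zero.2 hpq.symm
  rw [collinear_iff_of_mem (p₀ := p) (by simp)]
  refine ⟨q - p, ?_⟩
  rintro x (rfl | rfl | rfl)
  · exact ⟨0, by simp⟩
  · exact ⟨1, by simp⟩
  · refine ⟨(x.1 - p.1) / (q.1 - p.1), ?_⟩
    unfold cross at h
    ext
    · simp; field_simp; ring
    · simp; field_simp; linarith

theorem mem_convexHull_of_cross_pos {p q r s : ℝ × ℝ} {A : Set (ℝ × ℝ)}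
    (hp : p ∈ A) (hq : q ∈ A) (hr : r ∈ A)
    (h₁ : 0 < cross p q s) (h₂ : 0 < cross q r s) (h₃ : 0 < cross r p s) :
    s ∈ convexHull ℝ A := by
  set w := cross p q s + cross q r s + cross r p s with hw
  have hw0 : 0 < w := by positivity
  have hc := convex_convexHull ℝ A
  have hmem := hc.sum_mem (t := Finset.univ)
    (w := ![cross q r s / w, cross r p s / w, cross p q s / w]) (z := ![p, q, r]) ?_ ?_ ?_
  · convert hmem using 1
    simp only [Fin.sum_univ_three, Matrix.cons_val_zero, Matrix.cons_val_one, Matrix.cons_val]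
    ext
    · simp only [Prod.fst_add, Prod.smul_fst, smul_eq_mul]
      field_simp
      rw [hw]; unfold cross; ring
    · simp only [Prod.snd_add, Prod.smul_snd, smul_eq_mul]
      field_simp
      rw [hw]; unfold cross; ring
  · intro i _
    fin_cases i <;> simp <;> positivity
  · simp only [Fin.sum_univ_three, Matrix.cons_val_zero, Matrix.cons_val_one, Matrix.cons_val]
    field_simp
    rw [hw]; ring
  · intro i _
    fin_cases i <;> simp <;> exact subset_convexHull ℝ A ‹_›

theorem Config.of_set {S : Set (ℝ × ℝ)} (hfin : S.Finite) (hconv : ConvexPos S) (hgen : GenPos S)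
    {b t : ℝ × ℝ} (hb : IsBottommost S b) (ht : IsTopmost S t) (hbt : b.1 < t.1) :
    Config hfin.toFinset b t where
  b_mem := by simpa using hb.1
  t_mem := by simpa using ht.1
  b_low p hp := hb.2 p (by simpa using hp)
  t_high p hp := ht.2 p (by simpa using hp)
  b_left := hbt
  no_triangle := by
    intro p hp q hq r hr s hs h₁ h₂ h₃
    simp only [Set.Finite.mem_toFinset] at hp hq hr hs
    refine convexIndependent_set_iff_notMem_convexHull_sdiff.1 hconv s hs
      (mem_convexHull_of_cross_pos (p := p) (q := q) (r := r) ⟨hp, ?_⟩ ⟨hq, ?_⟩ ⟨hr, ?_⟩ h₁ h₂ h₃)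
    · rintro rfl; simp [cross] at h₁
    · rintro rfl; simp [cross] at h₂
    · rintro rfl; simp [cross] at h₃
  cross_ne := by
    intro p hp q hq r hr hpq hpr hqr h
    simp only [Set.Finite.mem_toFinset] at hp hq hr
    exact hgen.1 p hp q hq r hr hpq hpr hqr
      (collinear_of_cross_eq_zero (hgen.2 p hp q hq hpq).1 h)
  fst_ne p hp q hq h := (hgen.2 p (by simpa using hp) q (by simpa using hq) h).1
  snd_ne p hp q hq h := (hgen.2 p (by simpa using hp) q (by simpa using hq) h).2

namespace Config

variable {S : Finset (ℝ × ℝ)} {b t : ℝ × ℝ}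

theorem neg (h : Config S b t) : Config (-S) (-t) (-b) where
  b_mem := by simpa using h.t_mem
  t_mem := by simpa using h.b_mem
  b_low p hp hne := by
    have := h.t_high (-p) (by simpa using hp) (fun e => hne (by simp [← e]))
    simp at this ⊢; linarith
  t_high p hp hne := by
    have := h.b_low (-p) (by simpa using hp) (fun e => hne (by simp [← e]))
    simp at this ⊢; linarith
  b_left := by simpa using h.b_left
  no_triangle p hp q hq r hr s hs h₁ h₂ h₃ := by
    rw [← cross_neg] at h₁ h₂ h₃
    exact h.no_triangle (-p) (by simpa using hp) (-q) (by simpa using hq) (-r) (by simpa using hr)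
      (-s) (by simpa using hs) h₁ h₂ h₃
  cross_ne p hp q hq r hr hpq hpr hqr := by
    rw [← cross_neg]
    exact h.cross_ne (-p) (by simpa using hp) (-q) (by simpa using hq) (-r) (by simpa using hr)
      (by simpa using hpq) (by simpa using hpr) (by simpa using hqr)
  fst_ne p hp q hq hne := by
    have := h.fst_ne (-p) (by simpa using hp) (-q) (by simpa using hq) (by simpa using hne)
    simpa using this
  snd_ne p hp q hq hne := by
    have := h.snd_ne (-p) (by simpa using hp) (-q) (by simpa using hq) (by simpa using hne)
    simpa using this

theorem key_ne (h : Config S b t) (e : Dir) {p q : ℝ × ℝ} (hp : p ∈ S) (hq : q ∈ S)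
    (hne : p ≠ q) : e.key p ≠ e.key q := by
  have h₁ := h.fst_ne p hp q hq hne
  have h₂ := h.snd_ne p hp q hq hne
  cases e <;> simpa [Dir.key]

theorem b_lt_t (h : Config S b t) : b.2 < t.2 :=
  h.t_high b h.b_mem (fun e => by have := h.b_left; rw [e] at this; exact lt_irrefl _ this)

theorem cross_pos_bRR (h : Config S b t) {q r : ℝ × ℝ} (hq : q ∈ S) (hr : r ∈ S)
    (sq : cross b t q < 0) (sr : cross b t r < 0) (hqr : q.2 < r.2) : 0 < cross b q r := by
  have hqb : q ≠ b := by rintro rfl; simp [cross] at sq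
  have hrb : r ≠ b := by rintro rfl; simp [cross] at sr
  have hqr' : q ≠ r := by rintro rfl; exact lt_irrefl _ hqr
  by_contra hcon
  have hneg : cross b q r < 0 :=
    lt_of_le_of_ne (not_lt.1 hcon) (h.cross_ne b h.b_mem q hq r hr hqb.symm hrb.symm hqr')
  have hrt : r ≠ t := by rintro rfl; simp [cross] at sr; linarith
  have hbq := h.b_low q hq hqb
  have hrt' := h.t_high r hr hrt
  have key : cross r t q * (q.2 - b.2) =
      -cross b t q * (r.2 - q.2) - cross b q r * (t.2 - q.2) := by
    unfold cross; ring
  have hpos : 0 < cross r t q := by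
    have : 0 < cross r t q * (q.2 - b.2) := by
      rw [key]
      have h1 := mul_pos (neg_pos.2 sq) (sub_pos.2 hqr)
      have h2 := mul_pos (neg_pos.2 hneg) (sub_pos.2 (hqr.trans hrt'))
      linarith
    exact pos_of_mul_pos_left this (sub_pos.2 hbq).le
  refine h.no_triangle b h.b_mem r hr t h.t_mem q hq ?_ hpos ?_
  · have : cross b r q = -cross b q r := by unfold cross; ring
    linarith
  · have : cross t b q = -cross b t q := by unfold cross; ring
    linarith

theorem cross_pos_RRt (h : Config S b t) {q r : ℝ × ℝ} (hq : q ∈ S) (hr : r ∈ S)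
    (sq : cross b t q < 0) (sr : cross b t r < 0) (hqr : q.2 < r.2) : 0 < cross q r t := by
  have hqt : q ≠ t := by rintro rfl; simp [cross] at sq; linarith
  have hrt : r ≠ t := by rintro rfl; simp [cross] at sr; linarith
  have hrb : r ≠ b := by rintro rfl; simp [cross] at sr
  have hqr' : q ≠ r := by rintro rfl; exact lt_irrefl _ hqr
  by_contra hcon
  have hneg : cross q r t < 0 :=
    lt_of_le_of_ne (not_lt.1 hcon) (h.cross_ne q hq r hr t h.t_mem hqr' hqt hrt)
  have hbr := h.b_low r hr hrb
  have hrt' := h.t_high r hr hrt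
  have key : cross b q r * (t.2 - r.2) =
      -cross b t r * (r.2 - q.2) - cross q r t * (r.2 - b.2) := by
    unfold cross; ring
  have hpos : 0 < cross b q r := by
    have : 0 < cross b q r * (t.2 - r.2) := by
      rw [key]
      have h1 := mul_pos (neg_pos.2 sr) (sub_pos.2 hqr)
      have h2 := mul_pos (neg_pos.2 hneg) (sub_pos.2 hbr)
      linarith
    exact pos_of_mul_pos_left this (sub_pos.2 hrt').le
  refine h.no_triangle b h.b_mem q hq t h.t_mem r hr hpos ?_ ?_
  · have : cross q t r = -cross q r t := by unfold cross; ring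
    linarith
  · have : cross t b r = -cross b t r := by unfold cross; ring
    linarith

theorem cross_pos_RRR (h : Config S b t) {p q r : ℝ × ℝ} (hp : p ∈ S) (hq : q ∈ S) (hr : r ∈ S)
    (sp : cross b t p < 0) (sq : cross b t q < 0) (sr : cross b t r < 0)
    (hpq : p.2 < q.2) (hqr : q.2 < r.2) : 0 < cross p q r := by
  have hpq' : p ≠ q := by rintro rfl; exact lt_irrefl _ hpq
  have hqr' : q ≠ r := by rintro rfl; exact lt_irrefl _ hqr
  have hpr' : p ≠ r := by rintro rfl; exact lt_asymm hpq hqr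
  by_contra hcon
  have hneg : cross p q r < 0 :=
    lt_of_le_of_ne (not_lt.1 hcon) (h.cross_ne p hp q hq r hr hpq' hpr' hqr')
  have h1 := h.cross_pos_RRt hq hr sq sr hqr
  have h2 := h.cross_pos_RRt hp hq sp sq hpq
  refine h.no_triangle p hp r hr t h.t_mem q hq ?_ ?_ ?_
  · have : cross p r q = -cross p q r := by unfold cross; ring
    linarith
  · have : cross r t q = cross q r t := by unfold cross; ring
    linarith
  · have : cross t p q = cross p q t := by unfold cross; ring
    linarith

theorem cross_pos_RRL (h : Config S b t) {q r s : ℝ × ℝ} (hq : q ∈ S) (hr : r ∈ S) (hs : s ∈ S)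
    (sq : cross b t q < 0) (sr : cross b t r < 0) (ss : 0 < cross b t s)
    (hqr : q.2 < r.2) : 0 < cross q r s := by
  have h1 := h.cross_pos_bRR hq hr sq sr hqr
  have h2 := h.cross_pos_RRt hq hr sq sr hqr
  have hqt : q ≠ t := by rintro rfl; simp [cross] at sq; linarith
  have hqb : q ≠ b := by rintro rfl; simp [cross] at sq
  have hst : s ≠ t := by rintro rfl; simp [cross] at ss; linarith
  have hsb : s ≠ b := by rintro rfl; simp [cross] at ss
  have q1 := h.b_low q hq hqb
  have q2 := h.t_high q hq hqt
  have s1 := h.b_low s hs hsb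
  have s2 := h.t_high s hs hst
  have key : (t.2 - b.2) * (-cross b t q * cross q r s) =
      (-cross b t q * (t.2 - s.2) + cross b t s * (t.2 - q.2)) * cross b q r +
      (-cross b t q * (s.2 - b.2) + cross b t s * (q.2 - b.2)) * cross q r t := by
    unfold cross; ring
  have sq' := neg_pos.2 sq
  have : 0 < (t.2 - b.2) * (-cross b t q * cross q r s) := by
    rw [key]
    have := sub_pos.2 q1
    have := sub_pos.2 q2
    have := sub_pos.2 s1
    have := sub_pos.2 s2
    positivity
  exact pos_of_mul_pos_right (pos_of_mul_pos_right this (sub_pos.2 h.b_lt_t).le) sq'.le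

theorem cross_pos_bRL (h : Config S b t) {q r : ℝ × ℝ} (hq : q ∈ S) (hr : r ∈ S)
    (sq : cross b t q < 0) (sr : 0 < cross b t r) : 0 < cross b q r := by
  have hqb : q ≠ b := by rintro rfl; simp [cross] at sq
  have hrb : r ≠ b := by rintro rfl; simp [cross] at sr
  have q1 := sub_pos.2 (h.b_low q hq hqb)
  have r1 := sub_pos.2 (h.b_low r hr hrb)
  have key : (t.2 - b.2) * cross b q r =
      -cross b t q * (r.2 - b.2) + cross b t r * (q.2 - b.2) := by
    unfold cross; ring
  have sq' := neg_pos.2 sq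
  have : 0 < (t.2 - b.2) * cross b q r := by rw [key]; positivity
  exact pos_of_mul_pos_right this (sub_pos.2 h.b_lt_t).le

theorem cross_neg_endpoints (p : ℝ × ℝ) : cross (-t) (-b) (-p) = -cross b t p := by
  simp only [cross, Prod.fst_neg, Prod.snd_neg]; ring

/-- Position of a point in the counterclockwise order of the hull starting at `b`. -/
noncomputable def pos (b t p : ℝ × ℝ) : ℝ :=
  if 0 < cross b t p then 2 * t.2 - p.2 else p.2

theorem side_cases (h : Config S b t) {p : ℝ × ℝ} (hp : p ∈ S) :
    (p = b ∧ pos b t p = b.2) ∨ (p = t ∧ pos b t p = t.2) ∨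
    (cross b t p < 0 ∧ b.2 < p.2 ∧ p.2 < t.2 ∧ pos b t p = p.2) ∨
    (0 < cross b t p ∧ b.2 < p.2 ∧ p.2 < t.2 ∧ pos b t p = 2 * t.2 - p.2) := by
  by_cases hpb : p = b
  · left; subst hpb; simp [pos, cross]
  by_cases hpt : p = t
  · right; left; subst hpt
    have : cross b p p = 0 := by unfold cross; ring
    simp [pos, this]
  have hbt : b ≠ t := by intro e; have := h.b_left; rw [e] at this; exact lt_irrefl _ this
  have h1 := h.b_low p hp hpb
  have h2 := h.t_high p hp hpt
  rcases lt_or_gt_of_ne (h.cross_ne b h.b_mem t h.t_mem p hp hbt (Ne.symm hpb) (Ne.symm hpt))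
    with h3 | h3
  · right; right; left; exact ⟨h3, h1, h2, by simp [pos, not_lt.2 h3.le]⟩
  · right; right; right; exact ⟨h3, h1, h2, by simp [pos, h3]⟩

theorem cross_pos_of_pos_lt (h : Config S b t) {p q r : ℝ × ℝ} (hp : p ∈ S) (hq : q ∈ S)
    (hr : r ∈ S) (hpq : pos b t p < pos b t q) (hqr : pos b t q < pos b t r) :
    0 < cross p q r := by
  have hbt := h.b_lt_t
  have flip : ∀ {u : ℝ × ℝ}, 0 < cross b t u → cross (-t) (-b) (-u) < 0 := by
    intro u hu; rw [cross_neg_endpoints]; linarith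
  have flip' : ∀ {u : ℝ × ℝ}, cross b t u < 0 → 0 < cross (-t) (-b) (-u) := by
    intro u hu; rw [cross_neg_endpoints]; linarith
  have mem : ∀ {u : ℝ × ℝ}, u ∈ S → -u ∈ -S := by intro u hu; simpa using hu
  have rot : ∀ u v w, cross u v w = cross v w u := by intro u v w; unfold cross; ring
  have anti : ∀ u v w, cross u v w = -cross v u w := by intro u v w; unfold cross; ring
  have nlt : ∀ {u v : ℝ × ℝ}, v.2 < u.2 → (-u).2 < (-v).2 := by
    intro u v huv; simpa using huv
  rcases h.side_cases hp with ⟨rfl, ep⟩ | ⟨rfl, ep⟩ | ⟨sp, p1, p2, ep⟩ | ⟨sp, p1, p2, ep⟩ <;>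
  rcases h.side_cases hq with ⟨rfl, eq⟩ | ⟨rfl, eq⟩ | ⟨sq, q1, q2, eq⟩ | ⟨sq, q1, q2, eq⟩ <;>
  rcases h.side_cases hr with ⟨rfl, er⟩ | ⟨rfl, er⟩ | ⟨sr, r1, r2, er⟩ | ⟨sr, r1, r2, er⟩ <;>
  first | (exfalso; linarith) | skip
  · exact sr
  · rw [← rot, anti]; linarith
  · exact h.cross_pos_bRR hq hr sq sr (by linarith)
  · exact h.cross_pos_bRL hq hr sq sr
  · have := h.neg.cross_pos_RRt (mem hq) (mem hr) (flip sq) (flip sr) (nlt (by linarith))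
    rw [cross_neg] at this; rwa [rot]
  · have := h.neg.cross_pos_bRR (mem hq) (mem hr) (flip sq) (flip sr) (nlt (by linarith))
    rwa [cross_neg] at this
  · have := h.neg.cross_pos_bRL (mem hr) (mem hp) (flip sr) (flip' sp)
    rw [cross_neg] at this; rwa [rot]
  · exact h.cross_pos_RRt hp hq sp sq (by linarith)
  · exact h.cross_pos_RRR hp hq hr sp sq sr (by linarith) (by linarith)
  · exact h.cross_pos_RRL hp hq hr sp sq sr (by linarith)
  · have := h.neg.cross_pos_RRL (mem hq) (mem hr) (mem hp) (flip sq) (flip sr) (flip' sp)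
      (nlt (by linarith))
    rw [cross_neg] at this; rwa [rot]
  · have := h.neg.cross_pos_RRR (mem hp) (mem hq) (mem hr) (flip sp) (flip sq) (flip sr)
      (nlt (by linarith)) (nlt (by linarith))
    rwa [cross_neg] at this

theorem pos_injOn (h : Config S b t) {p q : ℝ × ℝ} (hp : p ∈ S) (hq : q ∈ S)
    (hpq : pos b t p = pos b t q) : p = q := by
  have hbt := h.b_lt_t
  by_contra hne
  have hy := h.snd_ne p hp q hq hne
  rcases h.side_cases hp with ⟨rfl, ep⟩ | ⟨rfl, ep⟩ | ⟨sp, p1, p2, ep⟩ | ⟨sp, p1, p2, ep⟩ <;>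
  rcases h.side_cases hq with ⟨rfl, eq⟩ | ⟨rfl, eq⟩ | ⟨sq, q1, q2, eq⟩ | ⟨sq, q1, q2, eq⟩ <;>
  first | exact hne rfl | linarith | exact hy (by linarith)

theorem fst_lt_of_left (h : Config S b t) {p q : ℝ × ℝ} (hp : p ∈ S) (hq : q ∈ S)
    (sp : 0 < cross b t p) (sq : 0 < cross b t q) (hqp : q.2 < p.2) (hbq : b.1 < q.1) :
    q.1 < p.1 := by
  have hqb : q ≠ b := by rintro rfl; simp [cross] at sq
  have h1 := h.b_low q hq hqb
  rcases h.side_cases hp with ⟨rfl, ep⟩ | ⟨rfl, ep⟩ | ⟨sp', p1, p2, ep⟩ | ⟨sp', p1, p2, ep⟩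
  · simp [cross] at sp
  · simp [cross] at sp; linarith
  · linarith
  rcases h.side_cases hq with ⟨rfl, eq⟩ | ⟨rfl, eq⟩ | ⟨sq', q1, q2, eq⟩ | ⟨sq', q1, q2, eq⟩
  · simp [cross] at sq
  · simp [cross] at sq; linarith
  · linarith
  have hb : pos b t b = b.2 := by simp [pos, cross]
  have hc := h.cross_pos_of_pos_lt h.b_mem hp hq (by rw [hb, ep]; linarith) (by rw [ep, eq]; linarith)
  unfold cross at hc
  by_contra hcon
  nlinarith [mul_pos (sub_pos.2 h1) (sub_pos.2 hbq), mul_pos (sub_pos.2 hqp) (sub_pos.2 hbq),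
    mul_nonneg (sub_nonneg.2 (not_lt.1 hcon)) (sub_pos.2 h1).le]

theorem fst_lt_of_right (h : Config S b t) {p q : ℝ × ℝ} (hp : p ∈ S) (hq : q ∈ S)
    (sp : cross b t p < 0) (sq : cross b t q < 0) (hqp : q.2 < p.2) (hpt : p.1 < t.1) :
    q.1 < p.1 := by
  have := h.neg.fst_lt_of_left (p := -q) (q := -p) (by simpa using hq) (by simpa using hp)
    (by rw [cross_neg_endpoints]; linarith) (by rw [cross_neg_endpoints]; linarith)
    (by simpa using hqp) (by simpa using hpt)
  simpa using this

end Config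

theorem cross_combo (p q u v : ℝ × ℝ) {α β : ℝ} (h : α + β = 1) :
    cross p q (α • u + β • v) = α * cross p q u + β * cross p q v := by
  obtain rfl : α = 1 - β := by linarith
  simp only [cross, Prod.fst_add, Prod.snd_add, Prod.smul_fst, Prod.smul_snd, smul_eq_mul]
  ring

theorem cross_eq_zero_of_mem_segment {p q x : ℝ × ℝ} (h : x ∈ segment ℝ p q) :
    cross p q x = 0 := by
  obtain ⟨α, β, -, -, hab, rfl⟩ := h
  rw [cross_combo _ _ _ _ hab]
  unfold cross; ring

theorem disjoint_segment_of_cross_mul_pos {p₁ p₂ q₁ q₂ : ℝ × ℝ}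
    (h : 0 < cross p₁ p₂ q₁ * cross p₁ p₂ q₂) :
    Disjoint (segment ℝ p₁ p₂) (segment ℝ q₁ q₂) := by
  rw [Set.disjoint_left]
  rintro x hp ⟨α, β, ha, hb, hab, rfl⟩
  have h0 := cross_eq_zero_of_mem_segment hp
  rw [cross_combo _ _ _ _ hab] at h0
  rcases pos_and_pos_or_neg_and_neg_of_mul_pos h with ⟨h₁, h₂⟩ | ⟨h₁, h₂⟩
  · rcases ha.eq_or_lt with rfl | ha
    · obtain rfl : β = 1 := by linarith
      linarith
    · have := mul_pos ha h₁
      have := mul_nonneg hb h₂.le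
      linarith
  · rcases ha.eq_or_lt with rfl | ha
    · obtain rfl : β = 1 := by linarith
      linarith
    · have := mul_neg_of_pos_of_neg ha h₁
      have := mul_nonpos_of_nonneg_of_nonpos hb h₂.le
      linarith

/-- No segment spanned by `T` meets a segment spanned by `S \ T`. -/
def Separated (S T : Finset (ℝ × ℝ)) : Prop :=
  ∀ p₁ ∈ T, ∀ p₂ ∈ T, ∀ q₁ ∈ S \ T, ∀ q₂ ∈ S \ T,
    Disjoint (segment ℝ p₁ p₂) (segment ℝ q₁ q₂)

theorem Separated.compl {S T : Finset (ℝ × ℝ)} (h : Separated S T) : Separated S (S \ T) := by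
  intro p₁ hp₁ p₂ hp₂ q₁ hq₁ q₂ hq₂
  have hT : ∀ q ∈ S \ (S \ T), q ∈ T := by
    intro q hq
    simp only [Finset.mem_sdiff] at hq
    tauto
  exact (h q₁ (hT q₁ hq₁) q₂ (hT q₂ hq₂) p₁ hp₁ p₂ hp₂).symm

theorem mem_segment_neg {p q x : ℝ × ℝ} (h : x ∈ segment ℝ p q) : -x ∈ segment ℝ (-p) (-q) := by
  obtain ⟨α, β, ha, hb, hab, rfl⟩ := h
  exact ⟨α, β, ha, hb, hab, by simp [add_comm]⟩

theorem Separated.neg {S T : Finset (ℝ × ℝ)} (h : Separated S T) : Separated (-S) (-T) := by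
  intro p₁ hp₁ p₂ hp₂ q₁ hq₁ q₂ hq₂
  have := h (-p₁) (by simpa using hp₁) (-p₂) (by simpa using hp₂) (-q₁) (by simpa using hq₁)
    (-q₂) (by simpa using hq₂)
  rw [Set.disjoint_left] at this ⊢
  exact fun x hx hx' => this (mem_segment_neg hx) (mem_segment_neg hx')

theorem separated_self (S : Finset (ℝ × ℝ)) : Separated S S := by
  intro p₁ _ p₂ _ q₁ hq₁
  simp at hq₁

/-- The first `k` edges of the labeled path `d` can be drawn on `T ⊆ S`, ending at `v`, such that
every initial part of the path is separated from the rest of `S`. -/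
inductive Reach (S : Finset (ℝ × ℝ)) (d : ℕ → Dir) : ℕ → Finset (ℝ × ℝ) → ℝ × ℝ → Prop
  | start {v : ℝ × ℝ} : v ∈ S → Separated S {v} → Reach S d 0 {v} v
  | step {k : ℕ} {T : Finset (ℝ × ℝ)} {v w : ℝ × ℝ} : Reach S d k T v → w ∈ S → w ∉ T →
      dirOk (d k) v w → Separated S (insert w T) → Reach S d (k + 1) (insert w T) w

namespace Reach

variable {S : Finset (ℝ × ℝ)} {d : ℕ → Dir}

theorem mem {k : ℕ} {T : Finset (ℝ × ℝ)} {v : ℝ × ℝ} (h : Reach S d k T v) : v ∈ T := by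
  cases h <;> simp

theorem subset {k : ℕ} {T : Finset (ℝ × ℝ)} {v : ℝ × ℝ} (h : Reach S d k T v) : T ⊆ S := by
  induction h with
  | start hv _ => simpa using hv
  | step _ hw _ _ _ ih => exact Finset.insert_subset hw ih

theorem separated {k : ℕ} {T : Finset (ℝ × ℝ)} {v : ℝ × ℝ} (h : Reach S d k T v) :
    Separated S T := by
  cases h <;> assumption

theorem exists_fun {k : ℕ} {T : Finset (ℝ × ℝ)} {v : ℝ × ℝ} (h : Reach S d k T v) :
    ∃ E : ℕ → ℝ × ℝ, (∀ i ≤ k, ∀ j ≤ k, E i = E j → i = j) ∧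
      (∀ p, p ∈ T ↔ ∃ i ≤ k, E i = p) ∧ E k = v ∧
      (∀ i < k, dirOk (d i) (E i) (E (i + 1))) ∧
      ∀ i ≤ k, Separated S ((Finset.range (i + 1)).image E) := by
  induction h with
  | @start v hv hs =>
    refine ⟨fun _ => v, ?_, ?_, rfl, ?_, ?_⟩
    · intro i hi j hj _; omega
    · intro p
      simp only [Finset.mem_singleton]
      exact ⟨fun h => ⟨0, le_rfl, h.symm⟩, fun ⟨_, _, h⟩ => h.symm⟩
    · intro i hi; omega
    · intro i hi
      obtain rfl : i = 0 := by omega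
      simpa using hs
  | @step k T v w hr hw hwT hd hs ih =>
    obtain ⟨E, hinj, him, hE, hdir, hsep⟩ := ih
    have hne : ∀ i ≤ k, E i ≠ w := fun i hi e => hwT ((him w).2 ⟨i, hi, e⟩)
    have hup : ∀ i ≤ k, Function.update E (k + 1) w i = E i := fun i hi =>
      Function.update_of_ne (by omega) _ _
    have hup' : Function.update E (k + 1) w (k + 1) = w := Function.update_self _ _ _
    refine ⟨Function.update E (k + 1) w, ?_, ?_, hup', ?_, ?_⟩
    · intro i hi j hj hij
      rcases Nat.lt_or_ge k i with hi' | hi' <;> rcases Nat.lt_or_ge k j with hj' | hj'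
      · omega
      · obtain rfl : i = k + 1 := by omega
        rw [hup', hup j hj'] at hij
        exact absurd hij.symm (hne j hj')
      · obtain rfl : j = k + 1 := by omega
        rw [hup', hup i hi'] at hij
        exact absurd hij (hne i hi')
      · rw [hup i hi', hup j hj'] at hij
        exact hinj i hi' j hj' hij
    · intro p
      rw [Finset.mem_insert, him]
      constructor
      · rintro (rfl | ⟨i, hi, rfl⟩)
        · exact ⟨k + 1, le_rfl, hup'⟩
        · exact ⟨i, by omega, hup i hi⟩
      · rintro ⟨i, hi, rfl⟩
        rcases Nat.lt_or_ge k i with hi' | hi'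
        · obtain rfl : i = k + 1 := by omega
          exact Or.inl hup'
        · exact Or.inr ⟨i, hi', (hup i hi').symm⟩
    · intro i hi
      rcases Nat.lt_or_ge i k with hi' | hi'
      · rw [hup i hi'.le, hup (i + 1) hi']
        exact hdir i hi'
      · obtain rfl : i = k := by omega
        rw [hup i le_rfl, hup', hE]
        exact hd
    · intro i hi
      have himage : ∀ j ≤ k, (Finset.range (j + 1)).image (Function.update E (k + 1) w) =
          (Finset.range (j + 1)).image E := fun j hj =>
        Finset.image_congr fun x hx => hup x (by simp at hx; omega)
      rcases Nat.lt_or_ge k i with hi' | hi'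
      · obtain rfl : i = k + 1 := by omega
        rw [Finset.range_add_one, Finset.image_insert, hup', himage k le_rfl]
        convert hs using 2
        ext p
        rw [him]
        simp only [Finset.mem_image, Finset.mem_range, Nat.lt_succ_iff]
      · rw [himage i hi']
        exact hsep i hi'

/-- A path drawn on part of `S` can be completed by a reversed path drawn on the rest. -/
theorem append_reverse {m k' : ℕ} {T' : Finset (ℝ × ℝ)} {v' : ℝ × ℝ}
    (h' : Reach (-S) (fun i => d (m - 1 - i)) k' T' v') :
    ∀ (k : ℕ) (v : ℝ × ℝ), k + k' + 1 = m → Reach S d k (S \ -T') v → dirOk (d k) v (-v') →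
      ∃ w, Reach S d m S w := by
  induction h' with
  | @start v' hv' _ =>
    intro k v hk h hd
    have hv : -v' ∈ S := by simpa using hv'
    have hS : insert (-v') (S \ -{v'}) = S := by
      ext p
      simp only [Finset.mem_insert, Finset.mem_sdiff, Finset.neg_singleton, Finset.mem_singleton]
      constructor
      · rintro (rfl | h)
        exacts [hv, h.1]
      · intro hp
        by_cases e : p = -v' <;> simp [e, hp]
    refine ⟨-v', ?_⟩
    have := Reach.step h hv (by simp) hd (by rw [hS]; exact separated_self S)
    rw [hS] at this
    obtain rfl : k + 1 = m := by omega
    exact this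
  | @step k' T' v' w' hr hw' hwT hd' hs ih =>
    intro k v hk h hd
    have hw : -w' ∈ S := by simpa using hw'
    have hS : insert (-w') (S \ -(insert w' T')) = S \ -T' := by
      ext p
      simp only [Finset.mem_insert, Finset.mem_sdiff, Finset.mem_neg']
      constructor
      · rintro (rfl | h)
        · simpa using ⟨hw, hwT⟩
        · exact ⟨h.1, fun h' => h.2 (Or.inr h')⟩
      · rintro ⟨hp, hp'⟩
        by_cases e : p = -w'
        · exact Or.inl e
        · exact Or.inr ⟨hp, fun h' => h'.elim (fun h' => e (by rw [← h']; simp)) hp'⟩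
    have hsep : Separated S (S \ -T') := by
      have := hr.separated.neg
      rw [neg_neg] at this
      exact this.compl
    refine ih (k + 1) (-w') (by omega) ?_ ?_
    · have := Reach.step h hw (by simp) hd (by rw [hS]; exact hsep)
      rwa [hS] at this
    · rw [dirOk_neg]
      convert hd' using 2
      omega

theorem exists_pdce {m : ℕ} {d : Fin m → Dir} {S : Set (ℝ × ℝ)} (hfin : S.Finite)
    {b t : ℝ × ℝ} (hS : Config hfin.toFinset b t) {d' : ℕ → Dir} (hd' : ∀ i : Fin m, d' i = d i)
    {v : ℝ × ℝ} (h : Reach hfin.toFinset d' m hfin.toFinset v) :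
    ∃ E : Fin (m + 1) → ℝ × ℝ, PDCE d E S := by
  obtain ⟨E, hinj, him, -, hdir, hsep⟩ := h.exists_fun
  have hmem : ∀ i ≤ m, E i ∈ hfin.toFinset := fun i hi => (him _).2 ⟨i, hi, rfl⟩
  refine ⟨fun i => E i, ⟨?_, ?_⟩, ?_, ?_, ?_⟩
  · intro i j hij
    exact Fin.ext (hinj i (by omega) j (by omega) hij)
  · ext p
    have := him p
    simp only [Set.Finite.mem_toFinset] at this
    rw [this]
    constructor
    · rintro ⟨i, rfl⟩; exact ⟨i, by omega, rfl⟩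
    · rintro ⟨i, hi, rfl⟩; exact ⟨⟨i, by omega⟩, rfl⟩
  · intro i
    have := hdir i i.2
    rw [hd' i] at this
    simpa using this
  · intro i j hij
    rw [← Set.disjoint_iff_inter_eq_empty]
    have hin : ∀ l ≤ i.1 + 1, E l ∈ (Finset.range (i.1 + 1 + 1)).image E := fun l hl =>
      Finset.mem_image_of_mem _ (by simp; omega)
    have hout : ∀ l ≤ m, i.1 + 1 < l →
        E l ∈ hfin.toFinset \ (Finset.range (i.1 + 1 + 1)).image E := by
      intro l hl hl'
      rw [Finset.mem_sdiff]
      refine ⟨hmem l hl, ?_⟩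
      simp only [Finset.mem_image, Finset.mem_range, not_exists, not_and]
      intro x hx e
      have := hinj x (by omega) l hl e
      omega
    have := hsep (i.1 + 1) (by omega) (E i) (hin _ (by omega)) (E (i.1 + 1)) (hin _ le_rfl)
      (E j) (hout _ (by omega) hij) (E (j.1 + 1)) (hout _ (by omega) (by omega))
    simpa using this
  · intro i j hij
    simp only [Fin.val_castSucc, Fin.val_succ, ← hij]
    apply Set.Subset.antisymm
    · rintro x ⟨hx, α, β, ha, hb, hab, rfl⟩
      have h0 := cross_eq_zero_of_mem_segment hx
      rw [cross_combo _ _ _ _ hab] at h0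
      have hq : cross (E i) (E (i.1 + 1)) (E (i.1 + 1)) = 0 := by unfold cross; ring
      have hne : cross (E i) (E (i.1 + 1)) (E (i.1 + 1 + 1)) ≠ 0 :=
        hS.cross_ne _ (hmem _ (by omega)) _ (hmem _ (by omega)) _ (hmem _ (by omega))
          (fun e => by have := hinj _ (by omega) _ (by omega) e; omega)
          (fun e => by have := hinj _ (by omega) _ (by omega) e; omega)
          (fun e => by have := hinj _ (by omega) _ (by omega) e; omega)
      rw [hq, mul_zero, zero_add] at h0
      obtain rfl : β = 0 := (mul_eq_zero.1 h0).resolve_right hne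
      obtain rfl : α = 1 := by linarith
      simp
    · rintro x rfl
      exact ⟨right_mem_segment _ _ _, left_mem_segment _ _ _⟩

/-- Draw the next edges on `M`, each label choosing the extreme remaining point in its direction.
The relation `before` restricts which subsets of `M` may be visited first. -/
theorem extend (before : ℝ × ℝ → ℝ × ℝ → Prop) :
    ∀ (M : Finset (ℝ × ℝ)) {k : ℕ} {T : Finset (ℝ × ℝ)} {v : ℝ × ℝ}, Reach S d k T v → M ⊆ S →
      Disjoint M T → (∀ e : Dir, ∀ p ∈ M, ∀ q ∈ M, p ≠ q → e.key p ≠ e.key q) →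
      (∀ q ∈ M, dirOk (d k) v q) →
      (∀ N ⊆ M, (∀ p ∈ N, ∀ q ∈ M, before q p → q ∈ N) → Separated S (T ∪ N)) →
      (∀ i, k < i → i < k + M.card → ∀ p ∈ M, ∀ q ∈ M, before q p → (d i).key q < (d i).key p) →
      ∃ v', Reach S d (k + M.card) (T ∪ M) v' ∧ (v' ∈ M ∨ M = ∅ ∧ v' = v) := by
  intro M
  induction hn : M.card generalizing M with
  | zero =>
    intro k T v h _ _ _ _ _ _
    obtain rfl := Finset.card_eq_zero.1 hn
    exact ⟨v, by simpa using h, Or.inr ⟨rfl, rfl⟩⟩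
  | succ n ih =>
    intro k T v h hMS hMT hkey hv hsep hlab
    obtain ⟨w, hw, hmin⟩ := M.exists_min_image (d (k + 1)).key
      (Finset.card_pos.1 (by omega))
    have hcard : (M.erase w).card = n := by rw [Finset.card_erase_of_mem hw]; omega
    have hwT : w ∉ T := Finset.disjoint_left.1 hMT hw
    have hfirst : ∀ q ∈ M, before q w → q = w := by
      intro q hq hqw
      by_contra hne
      have h2 : 1 < M.card := Finset.one_lt_card.2 ⟨q, hq, w, hw, hne⟩
      exact absurd (hlab (k + 1) (by omega) (by omega) w hw q hq hqw) (not_lt.2 (hmin q hq))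
    have hun : ∀ N : Finset (ℝ × ℝ), insert w T ∪ N = T ∪ insert w N := by
      intro N; ext p; simp only [Finset.mem_union, Finset.mem_insert]; tauto
    have hstep : Reach S d (k + 1) (insert w T) w := by
      refine Reach.step h (hMS hw) hwT (hv w hw) ?_
      have := hsep {w} (by simpa using hw) (by
        intro p hp q hq hqp
        obtain rfl := Finset.mem_singleton.1 hp
        simpa using hfirst q hq hqp)
      rwa [← insert_empty_eq w, ← hun, Finset.union_empty] at this
    have hsub : M.erase w ⊆ M := Finset.erase_subset w M
    have main : ∃ v', Reach S d (k + 1 + n) (insert w T ∪ M.erase w) v' ∧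
        (v' ∈ M.erase w ∨ M.erase w = ∅ ∧ v' = w) := by
      refine ih (M.erase w) hcard hstep (hsub.trans hMS) ?_ ?_ ?_ ?_ ?_
      · rw [Finset.disjoint_left]
        intro p hp hp'
        rcases Finset.mem_insert.1 hp' with rfl | hp'
        · simp at hp
        · exact Finset.disjoint_left.1 hMT (hsub hp) hp'
      · exact fun e p hp q hq => hkey e p (hsub hp) q (hsub hq)
      · intro q hq
        rw [dirOk_iff_key]
        exact lt_of_le_of_ne (hmin q (hsub hq))
          (hkey _ w hw q (hsub hq) (Finset.ne_of_mem_erase hq).symm)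
      · intro N hN hcl
        rw [hun]
        refine hsep _ (Finset.insert_subset hw (hN.trans hsub)) ?_
        intro p hp q hq hqp
        by_cases hqw : q = w
        · simp [hqw]
        · rcases Finset.mem_insert.1 hp with rfl | hp
          · exact absurd (hfirst q hq hqp) hqw
          · exact Finset.mem_insert_of_mem (hcl p hp q (Finset.mem_erase.2 ⟨hqw, hq⟩) hqp)
      · intro i hi hi' p hp q hq
        exact hlab i (by omega) (by omega) p (hsub hp) q (hsub hq)
    obtain ⟨v', hr, hv'⟩ := main
    refine ⟨v', ?_, Or.inl ?_⟩
    · rw [hun, Finset.insert_erase hw] at hr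
      rwa [show k + (n + 1) = k + 1 + n by omega]
    · rcases hv' with h' | ⟨-, rfl⟩
      exacts [hsub h', hw]

end Reach

namespace Config

variable {S : Finset (ℝ × ℝ)} {b t : ℝ × ℝ}

theorem cross_mul_pos (h : Config S b t) {p₁ p₂ q₁ q₂ : ℝ × ℝ} (hp₁ : p₁ ∈ S) (hp₂ : p₂ ∈ S)
    (hq₁ : q₁ ∈ S) (hq₂ : q₂ ∈ S) (hp : pos b t p₁ < pos b t p₂)
    (h₁ : pos b t q₁ ≠ pos b t p₁) (h₂ : pos b t q₁ ≠ pos b t p₂)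
    (h₃ : pos b t q₂ ≠ pos b t p₁) (h₄ : pos b t q₂ ≠ pos b t p₂)
    (hiff : (pos b t p₁ < pos b t q₁ ∧ pos b t q₁ < pos b t p₂) ↔
      (pos b t p₁ < pos b t q₂ ∧ pos b t q₂ < pos b t p₂)) :
    0 < cross p₁ p₂ q₁ * cross p₁ p₂ q₂ := by
  have hin : ∀ q ∈ S, pos b t p₁ < pos b t q ∧ pos b t q < pos b t p₂ → cross p₁ p₂ q < 0 := by
    rintro q hq ⟨a, c⟩
    have := h.cross_pos_of_pos_lt hp₁ hq hp₂ a c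
    have e : cross p₁ p₂ q = -cross p₁ q p₂ := by unfold cross; ring
    linarith
  have hout : ∀ q ∈ S, pos b t q ≠ pos b t p₁ → pos b t q ≠ pos b t p₂ →
      ¬ (pos b t p₁ < pos b t q ∧ pos b t q < pos b t p₂) → 0 < cross p₁ p₂ q := by
    intro q hq n₁ n₂ hn
    rcases lt_or_gt_of_ne n₁ with a | a
    · have := h.cross_pos_of_pos_lt hq hp₁ hp₂ a hp
      have e : cross p₁ p₂ q = cross q p₁ p₂ := by unfold cross; ring
      linarith
    · rcases lt_or_gt_of_ne n₂ with c | c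
      · exact absurd ⟨a, c⟩ hn
      · exact h.cross_pos_of_pos_lt hp₁ hp₂ hq hp c
  by_cases c : pos b t p₁ < pos b t q₁ ∧ pos b t q₁ < pos b t p₂
  · exact mul_pos_of_neg_of_neg (hin _ hq₁ c) (hin _ hq₂ (hiff.1 c))
  · exact mul_pos (hout _ hq₁ h₁ h₂ c) (hout _ hq₂ h₃ h₄ (fun c' => c (hiff.2 c')))

theorem separated_of_pos (h : Config S b t) {T : Finset (ℝ × ℝ)} (hT : T ⊆ S)
    (h₁ : ∀ p₁ ∈ T, ∀ p₂ ∈ T, ∀ q₁ ∈ S, q₁ ∉ T → ∀ q₂ ∈ S, q₂ ∉ T →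
      pos b t p₁ < pos b t q₁ → pos b t q₁ < pos b t p₂ → pos b t p₂ < pos b t q₂ → False)
    (h₂ : ∀ p₁ ∈ T, ∀ p₂ ∈ T, ∀ q₁ ∈ S, q₁ ∉ T → ∀ q₂ ∈ S, q₂ ∉ T →
      pos b t q₁ < pos b t p₁ → pos b t p₁ < pos b t q₂ → pos b t q₂ < pos b t p₂ → False) :
    Separated S T := by
  have hne : ∀ p ∈ T, ∀ q ∈ S, q ∉ T → pos b t q ≠ pos b t p := fun p hp q hq hqT e =>
    hqT (by rwa [h.pos_injOn hq (hT hp) e])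
  have main : ∀ p₁ ∈ T, ∀ p₂ ∈ T, ∀ q₁ ∈ S, q₁ ∉ T → ∀ q₂ ∈ S, q₂ ∉ T →
      pos b t p₁ < pos b t p₂ → 0 < cross p₁ p₂ q₁ * cross p₁ p₂ q₂ := by
    intro p₁ hp₁ p₂ hp₂ q₁ hq₁ hq₁T q₂ hq₂ hq₂T hp
    have n₁ := hne p₁ hp₁ q₁ hq₁ hq₁T
    have n₂ := hne p₂ hp₂ q₁ hq₁ hq₁T
    have n₃ := hne p₁ hp₁ q₂ hq₂ hq₂T
    have n₄ := hne p₂ hp₂ q₂ hq₂ hq₂T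
    have key : ∀ u ∈ S, u ∉ T → ∀ v ∈ S, v ∉ T → pos b t v ≠ pos b t p₁ → pos b t v ≠ pos b t p₂ →
        (pos b t p₁ < pos b t u ∧ pos b t u < pos b t p₂) →
        (pos b t p₁ < pos b t v ∧ pos b t v < pos b t p₂) := by
      rintro u hu huT v hv hvT m₁ m₂ ⟨a, c⟩
      refine ⟨lt_of_not_ge fun hle => ?_, lt_of_not_ge fun hle => ?_⟩
      · exact h₂ p₁ hp₁ p₂ hp₂ v hv hvT u hu huT (lt_of_le_of_ne hle m₁) a c
      · exact h₁ p₁ hp₁ p₂ hp₂ u hu huT v hv hvT a c (lt_of_le_of_ne hle m₂.symm)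
    exact h.cross_mul_pos (hT hp₁) (hT hp₂) hq₁ hq₂ hp n₁ n₂ n₃ n₄
      ⟨key q₁ hq₁ hq₁T q₂ hq₂ hq₂T n₃ n₄, key q₂ hq₂ hq₂T q₁ hq₁ hq₁T n₁ n₂⟩
  intro p₁ hp₁ p₂ hp₂ q₁ hq₁ q₂ hq₂
  obtain ⟨hq₁, hq₁T⟩ := Finset.mem_sdiff.1 hq₁
  obtain ⟨hq₂, hq₂T⟩ := Finset.mem_sdiff.1 hq₂
  rcases lt_trichotomy (pos b t p₁) (pos b t p₂) with hp | hp | hp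
  · exact disjoint_segment_of_cross_mul_pos (main p₁ hp₁ p₂ hp₂ q₁ hq₁ hq₁T q₂ hq₂ hq₂T hp)
  · obtain rfl := h.pos_injOn (hT hp₁) (hT hp₂) hp
    by_cases hq : q₁ = q₂
    · subst hq
      simp only [segment_same, Set.disjoint_singleton]
      rintro rfl
      exact hq₁T hp₁
    · refine (disjoint_segment_of_cross_mul_pos ?_).symm
      rw [← sq]
      exact pow_two_pos_of_ne_zero (h.cross_ne q₁ hq₁ q₂ hq₂ p₁ (hT hp₁) hq
        (fun e => hq₁T (e ▸ hp₁)) (fun e => hq₂T (e ▸ hp₁)))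
  · rw [segment_symm]
    exact disjoint_segment_of_cross_mul_pos (main p₂ hp₂ p₁ hp₁ q₁ hq₁ hq₁T q₂ hq₂ hq₂T hp)

/-- Two points lie strictly on the same side of the line through `b` and `t`. -/
def SameSide (b t p q : ℝ × ℝ) : Prop :=
  (0 < cross b t p ∧ 0 < cross b t q) ∨ (cross b t p < 0 ∧ cross b t q < 0)

theorem separated_of_low (h : Config S b t) {T : Finset (ℝ × ℝ)} (hT : T ⊆ S) (hb : b ∈ T)
    (ht : t ∉ T) (hlow : ∀ p ∈ T, ∀ q ∈ S, SameSide b t p q → q.2 < p.2 → q ∈ T) :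
    Separated S T := by
  have hbt := h.b_lt_t
  -- a missing point on the right is followed only by missing points up to the top
  have hR : ∀ q ∈ S, q ∉ T → ∀ p ∈ T, pos b t q < pos b t p → t.2 < pos b t p := by
    intro q hq hqT p hp hlt
    by_contra hcon
    refine hqT ?_
    rcases h.side_cases hq with ⟨rfl, e⟩ | ⟨rfl, e⟩ | ⟨s, y₁, y₂, e⟩ | ⟨s, y₁, y₂, e⟩
    · exact hb
    · linarith
    · rcases h.side_cases (hT hp) with ⟨rfl, f⟩ | ⟨rfl, f⟩ | ⟨s', z₁, z₂, f⟩ | ⟨s', z₁, z₂, f⟩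
      · linarith
      · exact absurd hp ht
      · exact hlow p hp q hq (Or.inr ⟨s', s⟩) (by linarith)
      · linarith
    · linarith
  have hL : ∀ q ∈ S, q ∉ T → ∀ p ∈ T, pos b t p < pos b t q → pos b t p < t.2 := by
    intro q hq hqT p hp hlt
    by_contra hcon
    refine hqT ?_
    rcases h.side_cases (hT hp) with ⟨rfl, f⟩ | ⟨rfl, f⟩ | ⟨s', z₁, z₂, f⟩ | ⟨s', z₁, z₂, f⟩
    · linarith
    · exact absurd hp ht
    · linarith
    · rcases h.side_cases hq with ⟨rfl, e⟩ | ⟨rfl, e⟩ | ⟨s, y₁, y₂, e⟩ | ⟨s, y₁, y₂, e⟩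
      · exact hb
      · linarith
      · linarith
      · exact hlow p hp q hq (Or.inl ⟨s', s⟩) (by linarith)
  refine h.separated_of_pos hT ?_ ?_
  · intro p₁ hp₁ p₂ hp₂ q₁ hq₁ hq₁T q₂ hq₂ hq₂T a c e
    have := hR q₁ hq₁ hq₁T p₂ hp₂ c
    have := hL q₂ hq₂ hq₂T p₂ hp₂ e
    linarith
  · intro p₁ hp₁ p₂ hp₂ q₁ hq₁ hq₁T q₂ hq₂ hq₂T a c e
    have := hR q₁ hq₁ hq₁T p₁ hp₁ a
    have := hL q₂ hq₂ hq₂T p₁ hp₁ c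
    linarith

/-- The left chain from `b` to `t`, including both endpoints. -/
noncomputable def leftChain (S : Finset (ℝ × ℝ)) (b t : ℝ × ℝ) : Finset (ℝ × ℝ) :=
  S.filter fun p => 0 < cross b t p ∨ p = b ∨ p = t

theorem mem_leftChain {p : ℝ × ℝ} :
    p ∈ leftChain S b t ↔ p ∈ S ∧ (0 < cross b t p ∨ p = b ∨ p = t) := by
  simp [leftChain]

theorem separated_of_leftChain (h : Config S b t) {T : Finset (ℝ × ℝ)}
    (hT : T ⊆ leftChain S b t)
    (hconv : ∀ p ∈ T, ∀ r ∈ T, ∀ q ∈ leftChain S b t, p.2 < q.2 → q.2 < r.2 → q ∈ T) :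
    Separated S T := by
  have hbt := h.b_lt_t
  have hTS : T ⊆ S := fun p hp => (mem_leftChain.1 (hT hp)).1
  have hchain : ∀ p ∈ T, (p = b ∧ pos b t p = b.2) ∨
      (b.2 < p.2 ∧ pos b t p = 2 * t.2 - p.2 ∧ p.2 ≤ t.2) := by
    intro p hp
    rcases h.side_cases (hTS hp) with ⟨rfl, e⟩ | ⟨rfl, e⟩ | ⟨s, y₁, y₂, e⟩ | ⟨s, y₁, y₂, e⟩
    · exact Or.inl ⟨rfl, e⟩
    · exact Or.inr ⟨hbt, by linarith, le_rfl⟩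
    · rcases (mem_leftChain.1 (hT hp)).2 with s' | rfl | rfl <;> linarith
    · exact Or.inr ⟨y₁, e, y₂.le⟩
  have hout : ∀ q ∈ S, b.2 ≤ pos b t q ∧ (q = b ∨ b.2 < q.2) ∧
      (t.2 ≤ pos b t q → q ∈ leftChain S b t ∧ pos b t q = 2 * t.2 - q.2) := by
    intro q hq
    rcases h.side_cases hq with ⟨rfl, e⟩ | ⟨rfl, e⟩ | ⟨s, y₁, y₂, e⟩ | ⟨s, y₁, y₂, e⟩
    · exact ⟨by linarith, Or.inl rfl, fun _ => by linarith⟩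
    · exact ⟨by linarith, Or.inr hbt,
        fun _ => ⟨mem_leftChain.2 ⟨hq, Or.inr (Or.inr rfl)⟩, by linarith⟩⟩
    · exact ⟨by linarith, Or.inr y₁, fun _ => by linarith⟩
    · exact ⟨by linarith, Or.inr y₁,
        fun _ => ⟨mem_leftChain.2 ⟨hq, Or.inl s⟩, by linarith⟩⟩
  refine h.separated_of_pos hTS ?_ ?_
  · intro p₁ hp₁ p₂ hp₂ q₁ hq₁ hq₁T q₂ hq₂ hq₂T a c e
    rcases hchain p₂ hp₂ with ⟨-, f₂⟩ | ⟨-, f₂, y₂⟩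
    · linarith [(hout _ hq₁).1]
    have o₂ := (hout q₂ hq₂).2.2 (by linarith)
    rcases hchain p₁ hp₁ with ⟨rfl, f₁⟩ | ⟨-, f₁, y₁⟩
    · refine hq₂T (hconv p₁ hp₁ p₂ hp₂ q₂ o₂.1 ?_ (by linarith))
      rcases (hout q₂ hq₂).2.1 with rfl | h'
      exacts [absurd hp₁ hq₂T, h']
    · have o₁ := (hout q₁ hq₁).2.2 (by linarith)
      exact hq₁T (hconv p₂ hp₂ p₁ hp₁ q₁ o₁.1 (by linarith) (by linarith))
  · intro p₁ hp₁ p₂ hp₂ q₁ hq₁ hq₁T q₂ hq₂ hq₂T a c e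
    rcases hchain p₁ hp₁ with ⟨-, f₁⟩ | ⟨-, f₁, y₁⟩
    · linarith [(hout _ hq₁).1]
    rcases hchain p₂ hp₂ with ⟨-, f₂⟩ | ⟨-, f₂, y₂⟩
    · linarith
    have o₂ := (hout q₂ hq₂).2.2 (by linarith)
    exact hq₂T (hconv p₂ hp₂ p₁ hp₁ q₂ o₂.1 (by linarith) (by linarith))

theorem cross_neg_of_leftChain (h : Config S b t) {p q r : ℝ × ℝ} (hp : p ∈ leftChain S b t)
    (hq : q ∈ leftChain S b t) (hr : r ∈ leftChain S b t) (hpq : p.2 < q.2) (hqr : q.2 < r.2) :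
    cross p q r < 0 := by
  have hpos : ∀ u ∈ leftChain S b t, ∀ w ∈ S, w.2 < u.2 → pos b t u = 2 * t.2 - u.2 := by
    intro u hu w hw hwu
    obtain ⟨huS, hu'⟩ := mem_leftChain.1 hu
    rcases h.side_cases huS with ⟨rfl, e⟩ | ⟨rfl, e⟩ | ⟨s, y₁, y₂, e⟩ | ⟨s, y₁, y₂, e⟩
    · by_cases hw' : w = u
      · rw [hw'] at hwu; linarith
      · linarith [h.b_low w hw hw']
    · linarith
    · rcases hu' with s' | rfl | rfl <;> linarith
    · exact e
  have hpS := (mem_leftChain.1 hp).1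
  have hqS := (mem_leftChain.1 hq).1
  have hrS := (mem_leftChain.1 hr).1
  have eq := hpos q hq p hpS hpq
  have er := hpos r hr q hqS hqr
  rcases h.side_cases hpS with ⟨rfl, e⟩ | ⟨rfl, e⟩ | ⟨s, y₁, y₂, e⟩ | ⟨s, y₁, y₂, e⟩
  · have := h.cross_pos_of_pos_lt hpS hrS hqS
      (by rcases h.side_cases hrS with ⟨rfl, f⟩ | ⟨rfl, f⟩ | ⟨-, y₁, y₂, f⟩ | ⟨-, y₁, y₂, f⟩ <;>
            linarith [h.b_lt_t]) (by linarith)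
    have : cross p q r = -cross p r q := by unfold cross; ring
    linarith
  · by_cases hr' : r = p
    · rw [hr'] at hqr; linarith
    · linarith [h.t_high r hrS hr']
  · rcases (mem_leftChain.1 hp).2 with s' | rfl | rfl <;> linarith
  · have := h.cross_pos_of_pos_lt hrS hqS hpS (by linarith) (by linarith)
    have : cross p q r = -cross r q p := by unfold cross; ring
    linarith

theorem reach_left (h : Config S b t) {d : ℕ → Dir} (hd : ∀ i, d i ≠ Dir.L) :
    ∀ (k : ℕ) (T : Finset (ℝ × ℝ)), T ⊆ leftChain S b t → T.card = k + 1 →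
      (∀ p ∈ T, ∀ r ∈ T, ∀ q ∈ leftChain S b t, p.2 < q.2 → q.2 < r.2 → q ∈ T) →
      ∃ v ∈ T, Reach S d k T v ∧
        ∀ k', k = k' + 1 → ∀ p ∈ T, p ≠ v → (d k').key p < (d k').key v := by
  intro k
  induction k with
  | zero =>
    intro T hT hcard hconv
    obtain ⟨v, rfl⟩ := Finset.card_eq_one.1 hcard
    have hv := (mem_leftChain.1 (hT (Finset.mem_singleton_self v))).1
    exact ⟨v, by simp, Reach.start hv (h.separated_of_leftChain hT hconv), by intro k' e; omega⟩
  | succ k ih =>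
    intro T hT hcard hconv
    have hTS : ∀ p ∈ T, p ∈ S := fun p hp => (mem_leftChain.1 (hT hp)).1
    obtain ⟨v, hv, hmax⟩ := T.exists_max_image (d k).key (Finset.card_pos.1 (by omega))
    have hlt : ∀ p ∈ T, p ≠ v → (d k).key p < (d k).key v := fun p hp hne =>
      lt_of_le_of_ne (hmax p hp) (h.key_ne _ (hTS p hp) (hTS v hv) hne)
    have hsub : T.erase v ⊆ T := Finset.erase_subset v T
    obtain ⟨w, hw, hr, -⟩ := ih (T.erase v) (hsub.trans hT)
      (by rw [Finset.card_erase_of_mem hv]; omega) (by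
        intro p hp r hr q hq hpq hqr
        refine Finset.mem_erase.2 ⟨?_, hconv p (hsub hp) r (hsub hr) q hq hpq hqr⟩
        rintro rfl
        have hp' := hmax p (hsub hp)
        have hr' := hmax r (hsub hr)
        cases hdk : d k with
        | U => simp only [hdk, Dir.key] at hr'; linarith
        | D => simp only [hdk, Dir.key] at hp'; linarith
        | L => exact hd k hdk
        | R =>
          simp only [hdk, Dir.key] at hp' hr'
          have hx := h.cross_neg_of_leftChain (hT (hsub hp)) hq (hT (hsub hr)) hpq hqr
          unfold cross at hx
          nlinarith [mul_nonneg (sub_nonneg.2 hp') (sub_pos.2 hqr).le,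
            mul_nonneg (sub_nonneg.2 hr') (sub_pos.2 hpq).le])
    refine ⟨v, hv, ?_, ?_⟩
    · have := Reach.step hr (hTS v hv) (Finset.notMem_erase v T)
        ((dirOk_iff_key ..).2 (hlt w (hsub hw) (Finset.ne_of_mem_erase hw)))
        (by rw [Finset.insert_erase hv]; exact h.separated_of_leftChain hT hconv)
      rwa [Finset.insert_erase hv] at this
    · intro k' e
      obtain rfl : k = k' := by omega
      exact hlt

end Config

theorem exists_initial_subset {α : Type*} [DecidableEq α] (f : α → ℝ) (M : Finset α)
    (hf : ∀ p ∈ M, ∀ q ∈ M, p ≠ q → f p ≠ f q) :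
    ∀ k ≤ M.card, ∃ K ⊆ M, K.card = k ∧ ∀ p ∈ K, ∀ q ∈ M, q ∉ K → f p < f q := by
  intro k
  induction k with
  | zero => exact fun _ => ⟨∅, by simp, by simp, by simp⟩
  | succ k ih =>
    intro hk
    obtain ⟨K, hKM, hK, hlt⟩ := ih (by omega)
    have hpos : 0 < (M \ K).card := by
      have := Finset.le_card_sdiff K M
      omega
    obtain ⟨w, hw, hmin⟩ := (M \ K).exists_min_image f (Finset.card_pos.1 hpos)
    obtain ⟨hwM, hwK⟩ := Finset.mem_sdiff.1 hw
    refine ⟨insert w K, Finset.insert_subset hwM hKM, by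
      rw [Finset.card_insert_of_notMem hwK, hK], ?_⟩
    intro p hp q hq hqK
    rw [Finset.mem_insert, not_or] at hqK
    rcases Finset.mem_insert.1 hp with rfl | hp
    · exact lt_of_le_of_ne (hmin q (Finset.mem_sdiff.2 ⟨hq, hqK.2⟩)) (hf p hwM q hq (Ne.symm hqK.1))
    · exact hlt p hp q hq hqK.2

namespace Config

variable {S : Finset (ℝ × ℝ)} {b t : ℝ × ℝ}

/-- The points of `S` strictly to the left of the line from `b` to `t`. -/
noncomputable def leftSide (S : Finset (ℝ × ℝ)) (b t : ℝ × ℝ) : Finset (ℝ × ℝ) :=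
  S.filter fun p => 0 < cross b t p

theorem mem_leftSide {p : ℝ × ℝ} : p ∈ leftSide S b t ↔ p ∈ S ∧ 0 < cross b t p := by
  simp [leftSide]

theorem cross_self_left (b t : ℝ × ℝ) : cross b t b = 0 := by simp [cross]

theorem cross_self_right (b t : ℝ × ℝ) : cross b t t = 0 := by unfold cross; ring

theorem b_ne_t (h : Config S b t) : b ≠ t := fun e => by
  have := h.b_left
  rw [e] at this
  exact lt_irrefl _ this

theorem card_leftSide_add (h : Config S b t) :
    (leftSide S b t).card + (leftSide (-S) (-t) (-b)).card + 2 = S.card := by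
  have e : leftSide (-S) (-t) (-b) = -(S.filter fun p => cross b t p < 0) := by
    ext p
    rw [mem_leftSide, Finset.mem_neg', Finset.mem_neg', Finset.mem_filter]
    have := cross_neg_endpoints (b := b) (t := t) (-p)
    rw [neg_neg] at this
    rw [this, neg_pos]
  have hdisj : Disjoint (leftSide S b t) (S.filter fun p => cross b t p < 0) := by
    rw [Finset.disjoint_left]
    intro p hp hp'
    have h₁ := (mem_leftSide.1 hp).2
    have h₂ := (Finset.mem_filter.1 hp').2
    linarith
  have hS : S = insert b (insert t (leftSide S b t ∪ S.filter fun p => cross b t p < 0)) := by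
    ext p
    simp only [Finset.mem_insert, Finset.mem_union, mem_leftSide, Finset.mem_filter]
    constructor
    · intro hp
      rcases h.side_cases hp with ⟨rfl, -⟩ | ⟨rfl, -⟩ | ⟨s, -⟩ | ⟨s, -⟩ <;> simp_all
    · rintro (rfl | rfl | ⟨hp, -⟩ | ⟨hp, -⟩)
      exacts [h.b_mem, h.t_mem, hp, hp]
  rw [e, Finset.card_neg]
  conv_rhs => rw [hS]
  rw [Finset.card_insert_of_notMem, Finset.card_insert_of_notMem, Finset.card_union_of_disjoint hdisj]
  · simp [mem_leftSide, cross_self_right]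
  · simp [mem_leftSide, cross_self_left, h.b_ne_t]

theorem cross_pos_of_fst_lt (h : Config S b t) {p : ℝ × ℝ} (hp : p ∈ S) (hpb : p.1 < b.1) :
    0 < cross b t p := by
  have hne : p ≠ b := by rintro rfl; exact lt_irrefl _ hpb
  have h₁ := mul_pos (sub_pos.2 h.b_left) (sub_pos.2 (h.b_low p hp hne))
  have h₂ := mul_pos (sub_pos.2 h.b_lt_t) (sub_pos.2 hpb)
  unfold cross
  linarith

theorem fst_lt_t_of_left (h : Config S b t) {p : ℝ × ℝ} (hp : p ∈ S) (sp : 0 < cross b t p) :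
    p.1 < t.1 := by
  by_contra hcon
  have := h.neg.cross_pos_of_fst_lt (p := -p) (by simpa using hp) (by
    rcases (not_lt.1 hcon).lt_or_eq with hlt | heq
    · simpa using hlt
    · have hne : t ≠ p := by rintro rfl; rw [cross_self_right] at sp; exact lt_irrefl _ sp
      exact absurd heq (h.fst_ne t h.t_mem p hp hne))
  rw [cross_neg_endpoints] at this
  linarith

/-- The points of `S` to the left of `b`. -/
noncomputable def leftOf (S : Finset (ℝ × ℝ)) (b : ℝ × ℝ) : Finset (ℝ × ℝ) :=
  S.filter fun p => p.1 < b.1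

theorem mem_leftOf {p : ℝ × ℝ} : p ∈ leftOf S b ↔ p ∈ S ∧ p.1 < b.1 := by
  simp [leftOf]

theorem leftOf_subset (h : Config S b t) : leftOf S b ⊆ leftSide S b t := fun _ hp =>
  mem_leftSide.2 ⟨(mem_leftOf.1 hp).1, h.cross_pos_of_fst_lt (mem_leftOf.1 hp).1 (mem_leftOf.1 hp).2⟩

/-- An initial part of the path drawn on `b` and the lowest points of the left side,
ending at `b`. -/
structure LowStart (S : Finset (ℝ × ℝ)) (b t : ℝ × ℝ) (d : ℕ → Dir) (i : ℕ)
    (A : Finset (ℝ × ℝ)) : Prop where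
  sub : A ⊆ S
  b_mem : b ∈ A
  left : ∀ p ∈ A, p ≠ b → 0 < cross b t p
  card : A.card = i + 1
  low : ∀ p ∈ A, ∀ q ∈ S, 0 < cross b t p → 0 < cross b t q → q.2 < p.2 → q ∈ A
  reach : Reach S d i A b

/-- An initial part of the path drawn on `t` and the highest points of the left side,
ending at `t`. -/
structure HighStart (S : Finset (ℝ × ℝ)) (b t : ℝ × ℝ) (d : ℕ → Dir) (i : ℕ)
    (A : Finset (ℝ × ℝ)) : Prop where
  sub : A ⊆ S
  t_mem : t ∈ A
  left : ∀ p ∈ A, p ≠ t → 0 < cross b t p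
  card : A.card = i + 1
  high : ∀ p ∈ A, ∀ q ∈ S, 0 < cross b t p → 0 < cross b t q → p.2 < q.2 → q ∈ A
  reach : Reach S d i A t

theorem exists_lowStart (h : Config S b t) {d : ℕ → Dir} (hd : ∀ i, d i ≠ Dir.L)
    (hL : d (leftSide S b t).card ≠ Dir.D) :
    ∃ i A, LowStart S b t d i A ∧ i ≤ (leftSide S b t).card ∧
      (∀ k, i ≤ k → k ≤ (leftSide S b t).card →
        d k ≠ Dir.D ∧ (k < (leftOf S b).card → d k = Dir.U)) ∧
      (leftOf S b \ A).card + i ≤ max (leftOf S b).card i := by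
  classical
  have hc : (leftOf S b).card ≤ (leftSide S b t).card := Finset.card_le_card h.leftOf_subset
  have hex : ∃ i, ∀ k, i ≤ k → k ≤ (leftSide S b t).card →
      d k ≠ Dir.D ∧ (k < (leftOf S b).card → d k = Dir.U) :=
    ⟨(leftSide S b t).card, fun k h₁ h₂ => by
      obtain rfl : k = (leftSide S b t).card := by omega
      exact ⟨hL, fun h₃ => by omega⟩⟩
  obtain ⟨i, hi, hmin⟩ : ∃ i, (∀ k, i ≤ k → k ≤ (leftSide S b t).card →
      d k ≠ Dir.D ∧ (k < (leftOf S b).card → d k = Dir.U)) ∧ ∀ j < i,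
      ¬ ∀ k, j ≤ k → k ≤ (leftSide S b t).card →
        d k ≠ Dir.D ∧ (k < (leftOf S b).card → d k = Dir.U) :=
    ⟨Nat.find hex, Nat.find_spec hex, fun j hj => Nat.find_min hex hj⟩
  have hiL : i ≤ (leftSide S b t).card := by
    by_contra hcon
    refine hmin _ (not_le.1 hcon) fun k h₁ h₂ => ?_
    obtain rfl : k = (leftSide S b t).card := by omega
    exact ⟨hL, fun h₃ => by omega⟩
  obtain ⟨K, hKL, hK, hlt⟩ := exists_initial_subset (fun p => p.2) (leftSide S b t)
    (fun p hp q hq => h.snd_ne p (mem_leftSide.1 hp).1 q (mem_leftSide.1 hq).1) i hiL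
  have hbK : b ∉ K := fun hb => by
    have := (mem_leftSide.1 (hKL hb)).2
    rw [cross_self_left] at this
    exact lt_irrefl _ this
  have hlow : ∀ p ∈ K, ∀ q ∈ leftSide S b t, q.2 < p.2 → q ∈ K := fun p hp q hq hqp => by
    by_contra hqK
    have := hlt p hp q hq hqK
    linarith
  -- the points left of `b` are the lowest ones of the left side
  have hdich : K ⊆ leftOf S b ∨ leftOf S b ⊆ K := by
    by_contra! hcon
    obtain ⟨⟨p, hp, hpC⟩, q, hq, hqK⟩ := And.imp Finset.not_subset.1 Finset.not_subset.1 hcon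
    have hpl := mem_leftSide.1 (hKL hp)
    have hql := mem_leftSide.1 (h.leftOf_subset hq)
    have hpb : p ≠ b := by rintro rfl; exact hbK hp
    have hbp : b.1 < p.1 := by
      rcases lt_or_gt_of_ne (h.fst_ne p hpl.1 b h.b_mem hpb) with h' | h'
      · exact absurd (mem_leftOf.2 ⟨hpl.1, h'⟩) hpC
      · exact h'
    have := h.fst_lt_of_left hql.1 hpl.1 hql.2 hpl.2
      (hlt p hp q (h.leftOf_subset hq) hqK) hbp
    linarith [(mem_leftOf.1 hq).2]
  have hcard : (insert b K).card = i + 1 := by rw [Finset.card_insert_of_notMem hbK, hK]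
  have hbC : b ∉ leftOf S b := by simp [mem_leftOf]
  refine ⟨i, insert b K, ⟨?_, Finset.mem_insert_self b K, ?_, hcard, ?_, ?_⟩, hiL, hi, ?_⟩
  · exact Finset.insert_subset h.b_mem fun p hp => (mem_leftSide.1 (hKL hp)).1
  · intro p hp hpb
    exact (mem_leftSide.1 (hKL (Finset.mem_of_mem_insert_of_ne hp hpb))).2
  · intro p hp q hq sp sq hqp
    have hpb : p ≠ b := by rintro rfl; rw [cross_self_left] at sp; exact lt_irrefl _ sp
    exact Finset.mem_insert_of_mem (hlow p (Finset.mem_of_mem_insert_of_ne hp hpb) q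
      (mem_leftSide.2 ⟨hq, sq⟩) hqp)
  · obtain ⟨v, hv, hr, hmax⟩ := h.reach_left hd i (insert b K) (by
        intro p hp
        rw [mem_leftChain]
        rcases Finset.mem_insert.1 hp with rfl | hp
        · exact ⟨h.b_mem, Or.inr (Or.inl rfl)⟩
        · exact ⟨(mem_leftSide.1 (hKL hp)).1, Or.inl (mem_leftSide.1 (hKL hp)).2⟩) hcard (by
        intro p _ r hr q hq _ hqr
        obtain ⟨hqS, hq | rfl | rfl⟩ := mem_leftChain.1 hq
        · rcases Finset.mem_insert.1 hr with rfl | hr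
          · have hqb : q ≠ r := by rintro rfl; exact lt_irrefl _ hqr
            linarith [h.b_low q hqS hqb]
          · exact Finset.mem_insert_of_mem (hlow r hr q (mem_leftSide.2 ⟨hqS, hq⟩) hqr)
        · exact Finset.mem_insert_self q K
        · rcases Finset.mem_insert.1 hr with rfl | hr
          · linarith [h.b_lt_t]
          · have hrS := mem_leftSide.1 (hKL hr)
            have hrq : r ≠ q := by rintro rfl; exact lt_irrefl _ hqr
            linarith [h.t_high r hrS.1 hrq])
    have hvb : v = b := by
      by_contra hvb
      have hvK := Finset.mem_of_mem_insert_of_ne hv hvb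
      have hi0 : 0 < i := by rw [← hK]; exact Finset.card_pos.2 ⟨v, hvK⟩
      obtain ⟨j, rfl⟩ : ∃ j, i = j + 1 := ⟨i - 1, by omega⟩
      have hkey := hmax j rfl b (Finset.mem_insert_self b K) (Ne.symm hvb)
      have hvS := (mem_leftSide.1 (hKL hvK)).1
      have hbv := h.b_low v hvS hvb
      have hbad : d j = Dir.D ∨ (j < (leftOf S b).card ∧ d j ≠ Dir.U) := by
        by_contra! hcon
        refine hmin j (by omega) fun k h₁ h₂ => ?_
        rcases h₁.eq_or_lt with rfl | h₁
        · exact hcon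
        · exact hi k h₁ h₂
      rcases hbad with hD | ⟨hj, hU⟩
      · simp only [hD, Dir.key] at hkey
        linarith
      · have hKC : K ⊆ leftOf S b := by
          rcases hdich with h' | h'
          · exact h'
          · exact (Finset.eq_of_subset_of_card_le h' (by omega)).ge
        have hvC := (mem_leftOf.1 (hKC hvK)).2
        cases hdj : d j with
        | U => exact hU hdj
        | D => simp only [hdj, Dir.key] at hkey; linarith
        | L => exact hd j hdj
        | R => simp only [hdj, Dir.key] at hkey; linarith
    rwa [hvb] at hr
  · rw [Finset.sdiff_insert, Finset.erase_eq_of_notMem (fun hb => hbC (Finset.mem_sdiff.1 hb).1)]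
    rcases hdich with h' | h'
    · rw [Finset.card_sdiff_of_subset h', hK]
      omega
    · rw [Finset.sdiff_eq_empty_iff_subset.2 h', Finset.card_empty]
      omega

theorem exists_highStart (h : Config S b t) {d : ℕ → Dir} (hd : ∀ i, d i ≠ Dir.L)
    (hL : d (leftSide S b t).card = Dir.D) :
    ∃ i A, HighStart S b t d i A ∧ i ≤ (leftSide S b t).card ∧
      ∀ k, i ≤ k → k ≤ (leftSide S b t).card → d k = Dir.D := by
  classical
  have hex : ∃ i, ∀ k, i ≤ k → k ≤ (leftSide S b t).card → d k = Dir.D :=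
    ⟨(leftSide S b t).card, fun k h₁ h₂ => by
      obtain rfl : k = (leftSide S b t).card := by omega
      exact hL⟩
  obtain ⟨i, hi, hmin⟩ : ∃ i, (∀ k, i ≤ k → k ≤ (leftSide S b t).card → d k = Dir.D) ∧
      ∀ j < i, ¬ ∀ k, j ≤ k → k ≤ (leftSide S b t).card → d k = Dir.D :=
    ⟨Nat.find hex, Nat.find_spec hex, fun j hj => Nat.find_min hex hj⟩
  have hiL : i ≤ (leftSide S b t).card := by
    by_contra hcon
    refine hmin _ (not_le.1 hcon) fun k h₁ h₂ => ?_
    obtain rfl : k = (leftSide S b t).card := by omega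
    exact hL
  obtain ⟨K, hKL, hK, hlt⟩ := exists_initial_subset (fun p => -p.2) (leftSide S b t)
    (fun p hp q hq hne => by
      simpa using h.snd_ne p (mem_leftSide.1 hp).1 q (mem_leftSide.1 hq).1 hne) i hiL
  have htK : t ∉ K := fun ht => by
    have := (mem_leftSide.1 (hKL ht)).2
    rw [cross_self_right] at this
    exact lt_irrefl _ this
  have hhigh : ∀ p ∈ K, ∀ q ∈ leftSide S b t, p.2 < q.2 → q ∈ K := fun p hp q hq hqp => by
    by_contra hqK
    have := hlt p hp q hq hqK
    linarith
  have hcard : (insert t K).card = i + 1 := by rw [Finset.card_insert_of_notMem htK, hK]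
  refine ⟨i, insert t K, ⟨?_, Finset.mem_insert_self t K, ?_, hcard, ?_, ?_⟩, hiL, hi⟩
  · exact Finset.insert_subset h.t_mem fun p hp => (mem_leftSide.1 (hKL hp)).1
  · intro p hp hpt
    exact (mem_leftSide.1 (hKL (Finset.mem_of_mem_insert_of_ne hp hpt))).2
  · intro p hp q hq sp sq hqp
    have hpt : p ≠ t := by rintro rfl; rw [cross_self_right] at sp; exact lt_irrefl _ sp
    exact Finset.mem_insert_of_mem (hhigh p (Finset.mem_of_mem_insert_of_ne hp hpt) q
      (mem_leftSide.2 ⟨hq, sq⟩) hqp)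
  · obtain ⟨v, hv, hr, hmax⟩ := h.reach_left hd i (insert t K) (by
        intro p hp
        rw [mem_leftChain]
        rcases Finset.mem_insert.1 hp with rfl | hp
        · exact ⟨h.t_mem, Or.inr (Or.inr rfl)⟩
        · exact ⟨(mem_leftSide.1 (hKL hp)).1, Or.inl (mem_leftSide.1 (hKL hp)).2⟩) hcard (by
        intro p hp r _ q hq hpq _
        obtain ⟨hqS, hq | rfl | rfl⟩ := mem_leftChain.1 hq
        · rcases Finset.mem_insert.1 hp with rfl | hp
          · have hqt : q ≠ p := by rintro rfl; exact lt_irrefl _ hpq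
            linarith [h.t_high q hqS hqt]
          · exact Finset.mem_insert_of_mem (hhigh p hp q (mem_leftSide.2 ⟨hqS, hq⟩) hpq)
        · rcases Finset.mem_insert.1 hp with rfl | hp
          · linarith [h.b_lt_t]
          · have hpS := mem_leftSide.1 (hKL hp)
            have hpq' : p ≠ q := by rintro rfl; exact lt_irrefl _ hpq
            linarith [h.b_low p hpS.1 hpq']
        · exact Finset.mem_insert_self q K)
    have hvt : v = t := by
      by_contra hvt
      have hvK := Finset.mem_of_mem_insert_of_ne hv hvt
      have hi0 : 0 < i := by rw [← hK]; exact Finset.card_pos.2 ⟨v, hvK⟩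
      obtain ⟨j, rfl⟩ : ∃ j, i = j + 1 := ⟨i - 1, by omega⟩
      have hkey := hmax j rfl t (Finset.mem_insert_self t K) (Ne.symm hvt)
      have hvS := mem_leftSide.1 (hKL hvK)
      have hvt₁ := h.fst_lt_t_of_left hvS.1 hvS.2
      have hvt₂ := h.t_high v hvS.1 hvt
      have hbad : d j ≠ Dir.D := by
        intro hcon
        refine hmin j (by omega) fun k h₁ h₂ => ?_
        rcases h₁.eq_or_lt with rfl | h₁
        · exact hcon
        · exact hi k h₁ h₂
      cases hdj : d j with
      | U => simp only [hdj, Dir.key] at hkey; linarith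
      | D => exact hbad hdj
      | L => exact hd j hdj
      | R => simp only [hdj, Dir.key] at hkey; linarith
    rwa [hvt] at hr

end Config

/-- The points of `S` used neither by an initial part drawn on `A` nor by a reversed initial part
drawn on `A' ⊆ -S`. -/
noncomputable def middle (S A A' : Finset (ℝ × ℝ)) : Finset (ℝ × ℝ) := (S \ A) \ -A'

section middle

variable {S A A' : Finset (ℝ × ℝ)}

theorem mem_middle {p : ℝ × ℝ} : p ∈ middle S A A' ↔ p ∈ S ∧ p ∉ A ∧ -p ∉ A' := by
  rw [middle, Finset.mem_sdiff, Finset.mem_sdiff, Finset.mem_neg', and_assoc]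

theorem middle_subset : middle S A A' ⊆ S := fun _ hp => (mem_middle.1 hp).1

theorem disjoint_middle : Disjoint (middle S A A') A :=
  Finset.disjoint_left.2 fun _ hp => (mem_middle.1 hp).2.1

theorem union_middle (hA : A ⊆ S) (hdisj : ∀ p ∈ A, -p ∉ A') :
    A ∪ middle S A A' = S \ -A' := by
  ext p
  rw [Finset.mem_union, mem_middle, Finset.mem_sdiff, Finset.mem_neg']
  constructor
  · rintro (hp | hp)
    exacts [⟨hA hp, hdisj p hp⟩, ⟨hp.1, hp.2.2⟩]
  · intro hp
    by_cases hpA : p ∈ A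
    exacts [Or.inl hpA, Or.inr ⟨hp.1, hpA, hp.2⟩]

theorem card_middle (hA : A ⊆ S) (hA' : A' ⊆ -S) (hdisj : ∀ p ∈ A, -p ∉ A') :
    A.card + (middle S A A').card + A'.card = S.card := by
  have hAS' : -A' ⊆ S := fun p hp => by simpa using hA' (Finset.mem_neg'.1 hp)
  have h₁ := Finset.card_union_of_disjoint (disjoint_middle (S := S) (A := A) (A' := A')).symm
  have h₂ := Finset.card_le_card hAS'
  rw [union_middle hA hdisj, Finset.card_sdiff_of_subset hAS', Finset.card_neg] at h₁
  rw [Finset.card_neg] at h₂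
  omega

end middle

namespace Config

variable {S : Finset (ℝ × ℝ)} {b t : ℝ × ℝ}

theorem SameSide.symm {p q : ℝ × ℝ} (h : SameSide b t p q) : SameSide b t q p :=
  h.imp And.symm And.symm

theorem SameSide.left_ne {p q : ℝ × ℝ} (h : SameSide b t p q) : p ≠ b ∧ p ≠ t := by
  constructor <;> rintro rfl <;> rcases h with h | h <;>
    simp [cross_self_left, cross_self_right] at h

theorem cross_neg_of_neg_left {p : ℝ × ℝ} (h : 0 < cross (-t) (-b) (-p)) : cross b t p < 0 := by
  rw [cross_neg_endpoints] at h
  linarith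

theorem cross_pos_of_neg_side {p : ℝ × ℝ} (h : cross b t p < 0) : 0 < cross (-t) (-b) (-p) := by
  rw [cross_neg_endpoints]
  linarith

theorem reach_of_D (h : Config S b t) {m : ℕ} {d : ℕ → Dir} (hd : ∀ i, d i ≠ Dir.L)
    (hm : S.card = m + 1) (hL : d (leftSide S b t).card = Dir.D) : ∃ v, Reach S d m S v := by
  classical
  have hsum := h.card_leftSide_add
  obtain ⟨i, A, hA, hiL, hi⟩ := h.exists_highStart hd hL
  obtain ⟨i', A', hA', hiL', hi'⟩ := h.neg.exists_highStart (d := fun k => d (m - 1 - k))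
    (fun k => hd _) (by
      show d _ = _
      rw [← hL]; congr 1; omega)
  have hright : ∀ p, -p ∈ A' → p ≠ b → cross b t p < 0 := fun p hp hpb =>
    cross_neg_of_neg_left (hA'.left (-p) hp (by simpa using hpb))
  have hbA : b ∉ A := fun hb => by
    have := hA.left b hb h.b_ne_t
    rw [cross_self_left] at this
    exact lt_irrefl _ this
  have hbA' : -b ∈ A' := hA'.t_mem
  have htA' : -t ∉ A' := fun ht => by
    have := hright _ ht h.b_ne_t.symm
    rw [cross_self_right] at this
    exact lt_irrefl _ this
  have hdisj : ∀ p ∈ A, -p ∉ A' := by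
    intro p hp hp'
    by_cases hpb : p = b
    · exact hbA (hpb ▸ hp)
    by_cases hpt : p = t
    · exact htA' (hpt ▸ hp')
    have h₁ := hA.left p hp hpt
    have h₂ := hright _ hp' hpb
    linarith
  have hcard := card_middle hA.sub hA'.sub hdisj
  rw [hA.card, hA'.card] at hcard
  have hAM := union_middle hA.sub hdisj
  set M := middle S A A'
  have hlab : ∀ k, i ≤ k → k ≤ i + M.card → d k = Dir.D := by
    intro k h₁ h₂
    by_cases hk : k ≤ (leftSide S b t).card
    · exact hi k h₁ hk
    · have := hi' (m - 1 - k) (by omega) (by omega)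
      rwa [show m - 1 - (m - 1 - k) = k by omega] at this
  obtain ⟨v, hr, hv⟩ := hA.reach.extend (fun q p => SameSide b t p q ∧ p.2 < q.2) M
    middle_subset disjoint_middle
    (fun e p hp q hq => h.key_ne e (middle_subset hp) (middle_subset hq))
    (fun q hq => by
      rw [hlab i le_rfl (by omega)]
      exact h.t_high q (middle_subset hq) fun e => (mem_middle.1 hq).2.1 (e ▸ hA.t_mem))
    (by
      intro N hN hcl
      have hsub : A ∪ N ⊆ S := Finset.union_subset hA.sub (hN.trans middle_subset)
      have : Separated S (S \ (A ∪ N)) := by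
        refine h.separated_of_low Finset.sdiff_subset ?_ ?_ ?_
        · rw [Finset.mem_sdiff, Finset.mem_union, not_or]
          exact ⟨h.b_mem, hbA, fun hb => (mem_middle.1 (hN hb)).2.2 hbA'⟩
        · simp [hA.t_mem]
        · intro p hp q hq hpq hlt
          rw [Finset.mem_sdiff, Finset.mem_union, not_or] at hp ⊢
          obtain ⟨hpS, hpA, hpN⟩ := hp
          refine ⟨hq, fun hqA => ?_, fun hqN => ?_⟩
          · have sq := hA.left q hqA hpq.symm.left_ne.2
            rcases hpq with h' | h'
            · exact hpA (hA.high q hqA p hpS h'.2 h'.1 hlt)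
            · linarith
          · have hqM := mem_middle.1 (hN hqN)
            by_cases hpA' : -p ∈ A'
            · have sp := hright _ hpA' hpq.left_ne.1
              rcases hpq with h' | h'
              · linarith
              · exact hqM.2.2 (hA'.high (-p) hpA' (-q) (by simpa using hq)
                  (cross_pos_of_neg_side h'.1) (cross_pos_of_neg_side h'.2) (by simpa using hlt))
            · exact hpN (hcl q hqN p (mem_middle.2 ⟨hpS, hpA, hpA'⟩) ⟨hpq.symm, hlt⟩)
      have := this.compl
      rwa [Finset.sdiff_sdiff_eq_self hsub] at this)
    (by
      intro k h₁ h₂ p _ q _ hqp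
      rw [hlab k h₁.le h₂.le]
      simpa [Dir.key] using hqp.2)
  rw [hAM] at hr
  refine hA'.reach.append_reverse (i + M.card) v (by omega) hr ?_
  rw [hlab _ (by omega) le_rfl, neg_neg]
  have hvb : v ≠ b := by
    rintro rfl
    have := hr.mem
    rw [Finset.mem_sdiff, Finset.mem_neg'] at this
    exact this.2 hbA'
  exact h.b_low v (hr.subset hr.mem) hvb

theorem reach_middle (h : Config S b t) {d : ℕ → Dir} {i : ℕ} {A M : Finset (ℝ × ℝ)}
    (hA : Reach S d i A b) (hMS : M ⊆ S) (hMA : Disjoint M A) (htM : t ∉ M)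
    (hsep : ∀ N ⊆ M, (∀ p ∈ N, ∀ q ∈ M, SameSide b t p q → q.2 < p.2 → q ∈ N) →
      Separated S (A ∪ N))
    (hlab : ∀ k, i ≤ k → k ≤ i + M.card → d k = Dir.U ∨ d k = Dir.R)
    (hfirst : ∀ k, i ≤ k → k ≤ i + M.card → d k = Dir.R →
      (M.filter fun p => p.1 < b.1).card + i ≤ k)
    (hlast : ∀ k, i ≤ k → k ≤ i + M.card → d k = Dir.R →
      k + (M.filter fun p => t.1 < p.1).card ≤ i + M.card) :
    ∃ v, Reach S d (i + M.card) (A ∪ M) v ∧ (t ≠ v → dirOk (d (i + M.card)) v t) := by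
  classical
  have hkey : ∀ e : Dir, ∀ p ∈ M, ∀ q ∈ M, p ≠ q → e.key p ≠ e.key q :=
    fun e p hp q hq => h.key_ne e (hMS hp) (hMS hq)
  have hbM : b ∉ M := fun hb => Finset.disjoint_left.1 hMA hb hA.mem
  have hbU : ∀ q ∈ M, b.2 < q.2 := fun q hq => h.b_low q (hMS hq) fun e => hbM (e ▸ hq)
  by_cases hR : ∃ k, i ≤ k ∧ k ≤ i + M.card ∧ d k = Dir.R
  swap
  · have hU : ∀ k, i ≤ k → k ≤ i + M.card → d k = Dir.U := fun k h₁ h₂ =>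
      (hlab k h₁ h₂).resolve_right fun h₃ => hR ⟨k, h₁, h₂, h₃⟩
    obtain ⟨v, hr, -⟩ := hA.extend (fun q p => SameSide b t p q ∧ q.2 < p.2) M hMS hMA hkey
      (fun q hq => by rw [hU i le_rfl (by omega)]; exact hbU q hq)
      (fun N hN hcl => hsep N hN fun p hp q hq h₁ h₂ => hcl p hp q hq ⟨h₁, h₂⟩)
      (fun k h₁ h₂ p _ q _ hqp => by rw [hU k h₁.le h₂.le]; exact hqp.2)
    refine ⟨v, hr, fun hvt => ?_⟩
    rw [hU _ (by omega) le_rfl]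
    exact h.t_high v (hr.subset hr.mem) hvt.symm
  obtain ⟨s, ⟨his, hsM, hds⟩, hsmin⟩ : ∃ s, (i ≤ s ∧ s ≤ i + M.card ∧ d s = Dir.R) ∧
      ∀ j < s, ¬ (i ≤ j ∧ j ≤ i + M.card ∧ d j = Dir.R) :=
    ⟨Nat.find hR, Nat.find_spec hR, fun j => Nat.find_min hR⟩
  obtain ⟨e, hse, heM, hde, hemax⟩ : ∃ e, s ≤ e ∧ e ≤ i + M.card ∧ d e = Dir.R ∧
      ∀ j, e < j → j ≤ i + M.card → d j = Dir.U := by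
    let P : ℕ → Prop := fun k => s ≤ k ∧ d k = Dir.R
    have hP : P s := ⟨le_rfl, hds⟩
    have hspec := Nat.findGreatest_spec (P := P) hsM hP
    refine ⟨Nat.findGreatest P (i + M.card), hspec.1, Nat.findGreatest_le _, hspec.2, ?_⟩
    intro j h₁ h₂
    exact (hlab j (by have := hspec.1; omega) h₂).resolve_right fun h₃ =>
      Nat.findGreatest_is_greatest h₁ h₂ ⟨by have := hspec.1; omega, h₃⟩
  have hUs : ∀ k, i ≤ k → k < s → d k = Dir.U := fun k h₁ h₂ =>
    (hlab k h₁ (by omega)).resolve_right fun h₃ => hsmin k h₂ ⟨h₁, by omega, h₃⟩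
  obtain ⟨K, hKM, hK, hKlt⟩ := exists_initial_subset (fun p => p.1) M
    (fun p hp q hq => h.fst_ne p (hMS hp) q (hMS hq)) (e - i) (by omega)
  obtain ⟨K₁, hK₁K, hK₁, hK₁lt'⟩ := exists_initial_subset (fun p => p.1) K
    (fun p hp q hq => h.fst_ne p (hMS (hKM hp)) q (hMS (hKM hq))) (s - i) (by omega)
  have hK₁M := hK₁K.trans hKM
  have hK₁lt : ∀ p ∈ K₁, ∀ q ∈ M, q ∉ K₁ → p.1 < q.1 := fun p hp q hq hqK => by
    by_cases hq' : q ∈ K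
    exacts [hK₁lt' p hp q hq' hqK, hKlt p (hK₁K hp) q hq hq']
  have hleft : ∀ q ∈ M, q ∉ K₁ → b.1 < q.1 := by
    intro q hq hqK
    by_contra hcon
    have hqb : q.1 < b.1 := lt_of_le_of_ne (not_lt.1 hcon)
      (h.fst_ne q (hMS hq) b h.b_mem fun e => hbM (e ▸ hq))
    have hsub : insert q K₁ ⊆ M.filter fun p => p.1 < b.1 := by
      refine Finset.insert_subset (Finset.mem_filter.2 ⟨hq, hqb⟩) fun p hp => ?_
      exact Finset.mem_filter.2 ⟨hK₁M hp, (hK₁lt p hp q hq hqK).trans hqb⟩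
    have h₁ := Finset.card_le_card hsub
    rw [Finset.card_insert_of_notMem hqK] at h₁
    have := hfirst s his hsM hds
    omega
  have hright : ∀ p ∈ K, p.1 < t.1 := by
    intro p hp
    by_contra hcon
    have htp : t.1 < p.1 := lt_of_le_of_ne (not_lt.1 hcon)
      (h.fst_ne t h.t_mem p (hMS (hKM hp)) fun e => htM (e ▸ hKM hp))
    have hsub : insert p (M \ K) ⊆ M.filter fun p => t.1 < p.1 := by
      refine Finset.insert_subset (Finset.mem_filter.2 ⟨hKM hp, htp⟩) fun q hq => ?_
      obtain ⟨hq, hqK⟩ := Finset.mem_sdiff.1 hq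
      exact Finset.mem_filter.2 ⟨hq, htp.trans (hKlt p hp q hq hqK)⟩
    have h₁ := Finset.card_le_card hsub
    rw [Finset.card_insert_of_notMem (by simp [hp]), Finset.card_sdiff_of_subset hKM] at h₁
    have := hlast e (by omega) heM hde
    omega
  have hmono : ∀ p ∈ M, ∀ q ∈ M, SameSide b t p q → q.2 < p.2 → p ∈ K → q ∉ K₁ → q.1 < p.1 := by
    intro p hp q hq hpq hlt hpK hqK
    rcases hpq with h' | h'
    · exact h.fst_lt_of_left (hMS hp) (hMS hq) h'.1 h'.2 hlt (hleft q hq hqK)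
    · exact h.fst_lt_of_right (hMS hp) (hMS hq) h'.1 h'.2 hlt (hright p hpK)
  have hclK : ∀ p ∈ K, ∀ q ∈ M, SameSide b t p q → q.2 < p.2 → q ∈ K := by
    intro p hp q hq hpq hlt
    by_contra hqK
    have h₁ := hmono p (hKM hp) q hq hpq hlt hp fun h' => hqK (hK₁K h')
    have h₂ := hKlt p hp q hq hqK
    linarith
  have hclK₁ : ∀ p ∈ K₁, ∀ q ∈ M, SameSide b t p q → q.2 < p.2 → q ∈ K₁ := by
    intro p hp q hq hpq hlt
    by_contra hqK
    have h₁ := hmono p (hK₁M hp) q hq hpq hlt (hK₁K hp) hqK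
    have h₂ := hK₁lt p hp q hq hqK
    linarith
  obtain ⟨v₁, hr₁, hv₁⟩ := hA.extend (fun q p => SameSide b t p q ∧ q.2 < p.2) K₁
    (hK₁M.trans hMS) (hMA.mono_left hK₁M)
    (fun e p hp q hq => hkey e p (hK₁M hp) q (hK₁M hq))
    (fun q hq => by
      have : 0 < K₁.card := Finset.card_pos.2 ⟨q, hq⟩
      rw [hUs i le_rfl (by omega)]
      exact hbU q (hK₁M hq))
    (fun N hN hcl => hsep N (hN.trans hK₁M) fun p hp q hq h₁ h₂ =>
      hcl p hp q (hclK₁ p (hN hp) q hq h₁ h₂) ⟨h₁, h₂⟩)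
    (fun k h₁ h₂ p _ q _ hqp => by rw [hUs k h₁.le (by omega)]; exact hqp.2)
  rw [show i + K₁.card = s by omega] at hr₁
  have hK₂ : (K \ K₁).card = e - s := by rw [Finset.card_sdiff_of_subset hK₁K]; omega
  obtain ⟨v₂, hr₂, hv₂⟩ := hr₁.extend (fun q p => SameSide b t p q ∧ q.2 < p.2) (K \ K₁)
    ((Finset.sdiff_subset.trans hKM).trans hMS)
    (Finset.disjoint_union_right.2
      ⟨hMA.mono_left (Finset.sdiff_subset.trans hKM), Finset.sdiff_disjoint⟩)
    (fun e p hp q hq => hkey e p (hKM (Finset.sdiff_subset hp)) q (hKM (Finset.sdiff_subset hq)))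
    (fun q hq => by
      obtain ⟨hq, hqK⟩ := Finset.mem_sdiff.1 hq
      rw [hds]
      rcases hv₁ with hv₁ | ⟨-, rfl⟩
      exacts [hK₁lt v₁ hv₁ q (hKM hq) hqK, hleft q (hKM hq) hqK])
    (fun N hN hcl => by
      rw [Finset.union_assoc]
      refine hsep _ (Finset.union_subset hK₁M ((hN.trans Finset.sdiff_subset).trans hKM)) ?_
      intro p hp q hq h₁ h₂
      rw [Finset.mem_union] at hp ⊢
      rcases hp with hp | hp
      · exact Or.inl (hclK₁ p hp q hq h₁ h₂)
      · by_cases hqK : q ∈ K₁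
        · exact Or.inl hqK
        · exact Or.inr (hcl p hp q (Finset.mem_sdiff.2
            ⟨hclK p (Finset.sdiff_subset (hN hp)) q hq h₁ h₂, hqK⟩) ⟨h₁, h₂⟩))
    (fun k h₁ h₂ p hp q hq hqp => by
      obtain ⟨hp, -⟩ := Finset.mem_sdiff.1 hp
      obtain ⟨hq, hqK⟩ := Finset.mem_sdiff.1 hq
      rcases hlab k (by omega) (by omega) with h' | h' <;> rw [h']
      exacts [hqp.2, hmono p (hKM hp) q (hKM hq) hqp.1 hqp.2 hp hqK])
  rw [Finset.union_assoc, Finset.union_sdiff_of_subset hK₁K, show s + (K \ K₁).card = e by omega]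
    at hr₂
  have hv₂' : v₂ ∈ K ∨ K = ∅ ∧ v₂ = b := by
    rcases hv₂ with hv₂ | ⟨h₁, rfl⟩
    · exact Or.inl (Finset.sdiff_subset hv₂)
    · rcases hv₁ with hv₁ | ⟨h₂, rfl⟩
      · exact Or.inl (hK₁K hv₁)
      · exact Or.inr ⟨by simpa [h₂] using h₁, rfl⟩
  have hK₃ : (M \ K).card = i + M.card - e := by rw [Finset.card_sdiff_of_subset hKM]; omega
  obtain ⟨v₃, hr₃, hv₃⟩ := hr₂.extend (fun q p => SameSide b t p q ∧ q.2 < p.2) (M \ K)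
    (Finset.sdiff_subset.trans hMS)
    (Finset.disjoint_union_right.2
      ⟨hMA.mono_left Finset.sdiff_subset, Finset.sdiff_disjoint⟩)
    (fun e p hp q hq => hkey e p (Finset.sdiff_subset hp) q (Finset.sdiff_subset hq))
    (fun q hq => by
      obtain ⟨hq, hqK⟩ := Finset.mem_sdiff.1 hq
      rw [hde]
      rcases hv₂' with hv | ⟨-, rfl⟩
      exacts [hKlt v₂ hv q hq hqK, hleft q hq fun h' => hqK (hK₁K h')])
    (fun N hN hcl => by
      rw [Finset.union_assoc]
      refine hsep _ (Finset.union_subset hKM (hN.trans Finset.sdiff_subset)) ?_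
      intro p hp q hq h₁ h₂
      rw [Finset.mem_union] at hp ⊢
      rcases hp with hp | hp
      · exact Or.inl (hclK p hp q hq h₁ h₂)
      · by_cases hqK : q ∈ K
        · exact Or.inl hqK
        · exact Or.inr (hcl p hp q (Finset.mem_sdiff.2 ⟨hq, hqK⟩) ⟨h₁, h₂⟩))
    (fun k h₁ h₂ p _ q _ hqp => by rw [hemax k h₁ (by omega)]; exact hqp.2)
  rw [Finset.union_assoc, Finset.union_sdiff_of_subset hKM,
    show e + (M \ K).card = i + M.card by omega] at hr₃
  refine ⟨v₃, hr₃, fun hvt => ?_⟩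
  rcases heM.lt_or_eq with hlt | heq
  · rw [hemax _ hlt le_rfl]
    exact h.t_high v₃ (hr₃.subset hr₃.mem) hvt.symm
  · rw [← heq, hde]
    rcases hv₃ with hv₃ | ⟨-, rfl⟩
    · have : 0 < (M \ K).card := Finset.card_pos.2 ⟨_, hv₃⟩
      omega
    · rcases hv₂' with hv | ⟨-, rfl⟩
      exacts [hright _ hv, h.b_left]

theorem reach_of_ne_D (h : Config S b t) {m : ℕ} {d : ℕ → Dir} (hd : ∀ i, d i ≠ Dir.L)
    (hm : S.card = m + 1) (hL : d (leftSide S b t).card ≠ Dir.D) : ∃ v, Reach S d m S v := by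
  classical
  have hsum := h.card_leftSide_add
  have hc := Finset.card_le_card h.leftOf_subset
  have hc' := Finset.card_le_card h.neg.leftOf_subset
  obtain ⟨i, A, hA, hiL, hi, hci⟩ := h.exists_lowStart hd hL
  obtain ⟨i', A', hA', hiL', hi', hci'⟩ := h.neg.exists_lowStart (d := fun k => d (m - 1 - k))
    (fun k => hd _) (by
      show d _ ≠ _
      convert hL using 2; omega)
  have hright : ∀ p, -p ∈ A' → p ≠ t → cross b t p < 0 := fun p hp hpt =>
    cross_neg_of_neg_left (hA'.left (-p) hp (by simpa using hpt))
  have htA : t ∉ A := fun ht => by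
    have := hA.left t ht h.b_ne_t.symm
    rw [cross_self_right] at this
    exact lt_irrefl _ this
  have htA' : -t ∈ A' := hA'.b_mem
  have hbA' : -b ∉ A' := fun hb => by
    have := hright _ hb h.b_ne_t
    rw [cross_self_left] at this
    exact lt_irrefl _ this
  have hdisj : ∀ p ∈ A, -p ∉ A' := by
    intro p hp hp'
    by_cases hpb : p = b
    · exact hbA' (hpb ▸ hp')
    by_cases hpt : p = t
    · exact htA (hpt ▸ hp)
    have h₁ := hA.left p hp hpb
    have h₂ := hright _ hp' hpt
    linarith
  have hcard := card_middle hA.sub hA'.sub hdisj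
  rw [hA.card, hA'.card] at hcard
  have hAM := union_middle hA.sub hdisj
  have htM : t ∉ middle S A A' := fun ht => (mem_middle.1 ht).2.2 htA'
  set M := middle S A A'
  have hlab : ∀ k, i ≤ k → k ≤ i + M.card → d k ≠ Dir.D ∧
      (k < (leftOf S b).card → d k = Dir.U) ∧ (m - 1 - k < (leftOf (-S) (-t)).card → d k = Dir.U) := by
    intro k h₁ h₂
    by_cases hk : k ≤ (leftSide S b t).card
    · obtain ⟨a, c⟩ := hi k h₁ hk
      refine ⟨a, c, fun h₃ => ?_⟩
      omega
    · obtain ⟨a, c⟩ := hi' (m - 1 - k) (by omega) (by omega)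
      rw [show m - 1 - (m - 1 - k) = k by omega] at a c
      exact ⟨a, fun h₃ => by omega, c⟩
  obtain ⟨v, hr, hv⟩ := h.reach_middle (M := M) hA.reach middle_subset disjoint_middle htM
    (by
      intro N hN hcl
      refine h.separated_of_low (Finset.union_subset hA.sub (hN.trans middle_subset))
        (Finset.mem_union_left _ hA.b_mem) ?_ ?_
      · rw [Finset.mem_union, not_or]
        exact ⟨htA, fun ht => htM (hN ht)⟩
      · intro p hp q hq hpq hlt
        rw [Finset.mem_union] at hp ⊢
        by_cases hqA : q ∈ A
        · exact Or.inl hqA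
        rcases hp with hp | hp
        · have sp := hA.left p hp hpq.left_ne.1
          rcases hpq with h' | h'
          · exact Or.inl (hA.low p hp q hq h'.1 h'.2 hlt)
          · linarith
        · by_cases hqA' : -q ∈ A'
          · have sq := hright q hqA' hpq.symm.left_ne.2
            rcases hpq with h' | h'
            · linarith
            · have hpM := mem_middle.1 (hN hp)
              exact absurd (hA'.low (-q) hqA' (-p) (by simpa using hpM.1)
                (cross_pos_of_neg_side h'.2) (cross_pos_of_neg_side h'.1) (by simpa using hlt))
                hpM.2.2
          · exact Or.inr (hcl p hp q (mem_middle.2 ⟨hq, hqA, hqA'⟩) hpq hlt))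
    (by
      intro k h₁ h₂
      have h₃ := (hlab k h₁ h₂).1
      have h₄ := hd k
      cases hk : d k <;> simp_all)
    (by
      intro k h₁ h₂ h₃
      have hck : (leftOf S b).card ≤ k := by
        by_contra hcon
        have := (hlab k h₁ h₂).2.1 (not_le.1 hcon)
        rw [h₃] at this
        cases this
      have hsub : (M.filter fun p => p.1 < b.1) ⊆ leftOf S b \ A := fun p hp => by
        obtain ⟨hpM, hpb⟩ := Finset.mem_filter.1 hp
        exact Finset.mem_sdiff.2 ⟨mem_leftOf.2 ⟨middle_subset hpM, hpb⟩, (mem_middle.1 hpM).2.1⟩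
      have := Finset.card_le_card hsub
      omega)
    (by
      intro k h₁ h₂ h₃
      have hck : (leftOf (-S) (-t)).card ≤ m - 1 - k := by
        by_contra hcon
        have := (hlab k h₁ h₂).2.2 (not_le.1 hcon)
        rw [h₃] at this
        cases this
      have hsub : -(M.filter fun p => t.1 < p.1) ⊆ leftOf (-S) (-t) \ A' := fun p hp => by
        obtain ⟨hpM, hpt⟩ := Finset.mem_filter.1 (Finset.mem_neg'.1 hp)
        have := mem_middle.1 hpM
        rw [neg_neg] at this
        refine Finset.mem_sdiff.2 ⟨mem_leftOf.2 ⟨Finset.mem_neg'.2 this.1, ?_⟩, this.2.2⟩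
        simp at hpt ⊢
        linarith
      have := Finset.card_le_card hsub
      rw [Finset.card_neg] at this
      omega)
  rw [hAM] at hr
  refine hA'.reach.append_reverse (i + M.card) v (by omega) hr ?_
  rw [neg_neg]
  refine hv ?_
  rintro rfl
  have := hr.mem
  rw [Finset.mem_sdiff, Finset.mem_neg'] at this
  exact this.2 htA'

end Config

/-- if t(S) is strictly to the right of b(S), every {U,D,R}-path admits a
PDCE on the convex point set S. -/
theorem UDR_pdce_of_topmost_right {m : ℕ} (d : Fin m → Dir)
    (hd : ∀ i, d i ≠ Dir.L) (S : Set (ℝ × ℝ)) (hfin : S.Finite)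
    (hcard : S.ncard = m + 1) (hconv : ConvexPos S) (hgen : GenPos S)
    (b t : ℝ × ℝ) (hb : IsBottommost S b) (ht : IsTopmost S t) (hbt : b.1 < t.1) :
    ∃ E : Fin (m + 1) → ℝ × ℝ, PDCE d E S := by
  classical
  have hS := Config.of_set hfin hconv hgen hb ht hbt
  have hm : hfin.toFinset.card = m + 1 := by rw [← hcard, Set.ncard_eq_toFinset_card S hfin]
  let d' : ℕ → Dir := fun k => if hk : k < m then d ⟨k, hk⟩ else Dir.U
  have hd' : ∀ k, d' k ≠ Dir.L := by
    intro k
    by_cases hk : k < m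
    · simpa [d', hk] using hd _
    · simp [d', hk]
  have hreach : ∃ v, Reach hfin.toFinset d' m hfin.toFinset v := by
    by_cases hL : d' (Config.leftSide hfin.toFinset b t).card = Dir.D
    exacts [hS.reach_of_D hd' hm hL, hS.reach_of_ne_D hd' hm hL]
  obtain ⟨v, hv⟩ := hreach
  exact hv.exists_pdce hfin hS (fun i => by simp [d'])
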